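/- Let n ≥ 1 and let 𝒬 be a real-analytic function defined in a neighborhood of (0,0,0) ∈ ℝ × ℝⁿ × ℝ^{n×n} satisfying 𝒬(0,0,0) = 0 and ∇𝒬(0,0,0) = 0. Then for any real parameters α₁, α₂, α₃, β ∈ ℝ and any integer N ≥ 1, there exists a family of functions {u_s : U_N → ℝ}_{s ∈ [−1,1]}, defined on a region U_N ⊆ ℝⁿ × (0,1) containing {(x,t) ∈ ℝⁿ × (0,1) : |x| ≤ e^{∘N}(1/t²)}, such that: (i) each u_s is smooth and satisfies ∂_t u_s + Δ u_s = s · t^β · 𝒬(t^{α₁} u_s, t^{α₂} ∇u_s, t^{α₃} D²u_s) on U_N, where Δ is the Euclidean Laplacian, ∇u_s the gradient, and D²u_s the Hessian matrix of u_s in the x-variables; (ii) each u_s extends continuously by 0 to t = 0 (u_s(x,0) = 0) and is not identically zero; (iii) limsup_{t→0⁺} ( sup_{|x| ≤ e^{∘N}(1/t²)} |u_s(x,t)| ) · e^{∘N}(1/t²) = 0. -/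

import Mathlib

open Filter

/-- Iterated exponential: `e^{∘0}(x) = x`, `e^{∘N}(x) = exp(e^{∘(N-1)}(x))`. -/
noncomputable def iterExp : ℕ → ℝ → ℝ
  | 0 => fun x => x
  | (N + 1) => fun x => Real.exp (iterExp N x)

/-- Partial derivative in the `i`-th coordinate direction. -/
noncomputable def pderiv' {n : ℕ} (i : Fin n) (f : (Fin n → ℝ) → ℝ) :
    (Fin n → ℝ) → ℝ :=
  fun x => deriv (fun y : ℝ => f (Function.update x i y)) (x i)

section Holomorphic

open Metric Topology

/-- Second order Taylor estimate for a bounded holomorphic function of one variable. -/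
theorem norm_taylor_one_sub_le {h : ℂ → ℂ} {C : ℝ} (hd : DifferentiableOn ℂ h (ball 0 2))
    (hC : ∀ z ∈ ball (0 : ℂ) 2, ‖h z‖ ≤ C) {k : ℂ} (hk : ‖k‖ ≤ 1 / 2) :
    ‖h k - h 0 - k * deriv h 0‖ ≤ 2 * C * ‖k‖ * ‖k‖ := by
  have hsub : closedBall (0 : ℂ) (1 / 2) ⊆ ball 0 2 := closedBall_subset_ball (by norm_num)
  have hdd : DifferentiableOn ℂ (deriv h) (ball 0 2) := hd.deriv isOpen_ball
  have h2 : ∀ s ∈ closedBall (0 : ℂ) (1 / 2), ‖deriv (deriv h) s‖ ≤ 2 * C := by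
    intro s hs
    have hs' : closedBall s 1 ⊆ ball 0 2 := by
      intro y hy
      rw [mem_closedBall, dist_eq_norm] at hy hs
      rw [mem_ball, dist_eq_norm]
      rw [sub_zero] at *
      calc ‖y‖ = ‖(y - s) + s‖ := by ring_nf
        _ ≤ ‖y - s‖ + ‖s‖ := norm_add_le _ _
        _ < 2 := by linarith
    have := Complex.norm_iteratedDeriv_le_of_forall_mem_sphere_norm_le (c := s) (R := 1) (C := C)
      (f := h) 2 one_pos ((hd.mono hs').diffContOnCl_ball subset_rfl)
      (fun z hz => hC z (hs' (sphere_subset_closedBall hz)))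
    simpa [iteratedDeriv_succ] using this
  have hat : ∀ s ∈ closedBall (0 : ℂ) (1 / 2), DifferentiableAt ℂ h s := fun s hs =>
    hd.differentiableAt (isOpen_ball.mem_nhds (hsub hs))
  have hat' : ∀ s ∈ closedBall (0 : ℂ) (1 / 2), DifferentiableAt ℂ (deriv h) s := fun s hs =>
    hdd.differentiableAt (isOpen_ball.mem_nhds (hsub hs))
  have hk0 : closedBall (0 : ℂ) ‖k‖ ⊆ closedBall 0 (1 / 2) := closedBall_subset_closedBall hk
  have h1 : ∀ s ∈ closedBall (0 : ℂ) ‖k‖, ‖deriv h s - deriv h 0‖ ≤ 2 * C * ‖k‖ := by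
    intro s hs
    have hC0 : 0 ≤ 2 * C := (norm_nonneg _).trans (h2 s (hk0 hs))
    have := (convex_closedBall (0 : ℂ) (1 / 2)).norm_image_sub_le_of_norm_deriv_le
      (f := deriv h) hat' h2 (x := 0) (y := s) (by simp) (hk0 hs)
    rw [sub_zero] at this
    refine this.trans ?_
    gcongr
    simpa using hs
  have hat2 : ∀ s ∈ closedBall (0 : ℂ) ‖k‖,
      DifferentiableAt ℂ (fun s => h s - s * deriv h 0) s := fun s hs =>
    (hat s (hk0 hs)).sub (differentiableAt_id.mul_const _)
  have := (convex_closedBall (0 : ℂ) ‖k‖).norm_image_sub_le_of_norm_deriv_le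
      (f := fun s => h s - s * deriv h 0) hat2 (C := 2 * C * ‖k‖) (fun s hs => by
        have e : deriv (fun s => h s - s * deriv h 0) s = deriv h s - deriv h 0 := by
          have h1 : HasDerivAt (fun s => h s - s * deriv h 0) (deriv h s - 1 * deriv h 0) s :=
            (hat s (hk0 hs)).hasDerivAt.sub ((hasDerivAt_id s).mul_const (deriv h 0))
          rw [h1.deriv, one_mul]
        rw [e]; exact h1 s hs) (x := 0) (y := k) (by simp) (by simp)
  simp only [zero_mul, sub_zero] at this
  rwa [sub_right_comm] at this

variable {E : Type*} [NormedAddCommGroup E] [NormedSpace ℂ E]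

theorem norm_fderiv_le_of_ball {f : E → ℂ} {p : E} {δ C : ℝ} (hδ : 0 < δ)
    (hd : DifferentiableOn ℂ f (ball p δ)) (hC : ∀ x ∈ ball p δ, ‖f x‖ ≤ C) :
    ‖fderiv ℂ f p‖ ≤ 2 * C / δ := by
  have hC0 : 0 ≤ C := (norm_nonneg _).trans (hC p (mem_ball_self hδ))
  refine ContinuousLinearMap.opNorm_le_bound _ (by positivity) fun v => ?_
  rcases eq_or_ne v 0 with rfl | hv
  · simp
  have hv' : 0 < ‖v‖ := norm_pos_iff.2 hv
  have hmaps : ∀ k ∈ closedBall (0 : ℂ) (δ / (2 * ‖v‖)), p + k • v ∈ ball p δ := by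
    intro k hk
    rw [mem_closedBall, dist_zero_right] at hk
    rw [mem_ball, dist_eq_norm, add_sub_cancel_left, norm_smul]
    calc ‖k‖ * ‖v‖ ≤ δ / (2 * ‖v‖) * ‖v‖ := by gcongr
      _ = δ / 2 := by field_simp
      _ < δ := by linarith
  have hline : ∀ k : ℂ, HasDerivAt (fun k : ℂ => p + k • v) v k := fun k => by
    simpa using ((hasDerivAt_id k).smul_const v).const_add p
  have hdiff : DifferentiableOn ℂ (fun k : ℂ => f (p + k • v))
      (closedBall 0 (δ / (2 * ‖v‖))) :=
    hd.comp (fun k _ => (hline k).differentiableAt.differentiableWithinAt) hmaps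
  have hder : deriv (fun k : ℂ => f (p + k • v)) 0 = fderiv ℂ f p v := by
    have h0 : HasFDerivAt f (fderiv ℂ f p) (p + (0 : ℂ) • v) := by
      simpa using (hd.differentiableAt (isOpen_ball.mem_nhds (mem_ball_self hδ))).hasFDerivAt
    exact (h0.comp_hasDerivAt (0 : ℂ) (hline 0)).deriv
  rw [← hder]
  have := Complex.norm_deriv_le_of_forall_mem_sphere_norm_le (c := 0) (C := C)
    (f := fun k : ℂ => f (p + k • v)) (R := δ / (2 * ‖v‖)) (by positivity)
    (hdiff.diffContOnCl_ball subset_rfl)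
    (fun z hz => hC _ (hmaps z (sphere_subset_closedBall hz)))
  refine this.trans (le_of_eq ?_)
  field_simp

/-- Uniform limits of holomorphic functions on open subsets of a normed space are holomorphic. -/
theorem differentiableOn_of_tendstoUniformlyOn {F : ℕ → E → ℂ} {f : E → ℂ} {U : Set E}
    (hU : IsOpen U) (hF : ∀ n, DifferentiableOn ℂ (F n) U) (hlim : TendstoUniformlyOn F f atTop U) :
    DifferentiableOn ℂ f U := by
  intro p hp
  obtain ⟨δ, hδ, hsub⟩ := Metric.isOpen_iff.1 hU p hp
  have hballs : ∀ x ∈ ball p (δ / 2), ball x (δ / 2) ⊆ U := fun x hx y hy => by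
    apply hsub
    rw [mem_ball] at *
    linarith [dist_triangle y x p]
  have hxU : ball p (δ / 2) ⊆ U := (ball_subset_ball (by linarith)).trans hsub
  have hcau : UniformCauchySeqOn (fun n => fderiv ℂ (F n)) atTop (ball p (δ / 2)) := by
    rw [Metric.uniformCauchySeqOn_iff]
    intro ε hε
    obtain ⟨n, hn⟩ := Metric.uniformCauchySeqOn_iff.1 hlim.uniformCauchySeqOn (ε * δ / 8)
      (by positivity)
    refine ⟨n, fun m hm k hk x hx => ?_⟩
    have hdm : ∀ j, DifferentiableAt ℂ (F j) x := fun j =>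
      (hF j).differentiableAt (hU.mem_nhds (hxU hx))
    rw [dist_eq_norm, ← fderiv_sub (hdm m) (hdm k)]
    have := norm_fderiv_le_of_ball (f := F m - F k) (p := x) (δ := δ / 2) (C := ε * δ / 8)
      (by positivity) (((hF m).sub (hF k)).mono (hballs x hx)) (fun y hy => by
        have := hn m hm k hk y (hballs x hx hy)
        rw [dist_eq_norm] at this
        exact this.le)
    refine this.trans_lt ?_
    have : 2 * (ε * δ / 8) / (δ / 2) = ε / 2 := by field_simp; norm_num
    rw [this]; linarith
  have hpt : ∀ x ∈ ball p (δ / 2), Tendsto (fun n => fderiv ℂ (F n) x) atTop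
      (𝓝 (limUnder atTop (fun n => fderiv ℂ (F n) x))) := fun x hx =>
    (hcau.cauchySeq hx).tendsto_limUnder
  have hunif := hcau.tendstoUniformlyOn_of_tendsto hpt
  have := hasFDerivAt_of_tendstoUniformlyOn isOpen_ball hunif
    (fun n x hx => ((hF n).differentiableAt (hU.mem_nhds (hxU hx))).hasFDerivAt)
    (fun x hx => hlim.tendsto_at (hxU hx)) (mem_ball_self (half_pos hδ))
  exact this.differentiableAt.differentiableWithinAt

theorem differentiableOn_fderiv_apply {f : E → ℂ} {U : Set E} (hU : IsOpen U)
    (hf : DifferentiableOn ℂ f U) (v : E) : DifferentiableOn ℂ (fun x => fderiv ℂ f x v) U := by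
  intro p hp
  rcases eq_or_ne v 0 with rfl | hv
  · simpa using differentiableWithinAt_const (0 : ℂ)
  have hv' : 0 < ‖v‖ := norm_pos_iff.2 hv
  obtain ⟨δ, hδ, hsub⟩ : ∃ δ > 0, ball p δ ⊆ U ∩ {x | ‖f x‖ < ‖f p‖ + 1} := by
    have h1 : {x | ‖f x‖ < ‖f p‖ + 1} ∈ 𝓝 p :=
      ((hf.differentiableAt (hU.mem_nhds hp)).continuousAt.norm).eventually_lt_const (by simp)
    exact Metric.mem_nhds_iff.1 (inter_mem (hU.mem_nhds hp) h1)
  set c : ℂ := ((δ / (4 * ‖v‖) : ℝ) : ℂ) with hc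
  have hcpos : 0 < δ / (4 * ‖v‖) := by positivity
  have hcn : ‖c‖ = δ / (4 * ‖v‖) := by
    rw [hc, Complex.norm_real, Real.norm_eq_abs, abs_of_pos hcpos]
  have hc0 : c ≠ 0 := by rw [← norm_pos_iff, hcn]; exact hcpos
  have hin : ∀ x ∈ ball p (δ / 2), ∀ k ∈ ball (0 : ℂ) 2, x + (k * c) • v ∈ ball p δ := by
    intro x hx k hk
    rw [mem_ball, dist_eq_norm] at *
    rw [sub_zero] at hk
    calc ‖x + (k * c) • v - p‖ = ‖(x - p) + (k * c) • v‖ := by congr 1; abel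
      _ ≤ ‖x - p‖ + ‖(k * c) • v‖ := norm_add_le _ _
      _ = ‖x - p‖ + ‖k‖ * (δ / 4) := by
          rw [norm_smul, norm_mul, hcn]; field_simp
      _ < δ := by nlinarith
  have hline : ∀ x : E, ∀ k : ℂ, HasDerivAt (fun k : ℂ => x + (k * c) • v) (c • v) k := fun x k => by
    simpa using (((hasDerivAt_id k).mul_const c).smul_const v).const_add x
  have hest : ∀ x ∈ ball p (δ / 2), ∀ k : ℂ, ‖k‖ ≤ 1 / 2 →
      ‖f (x + (k * c) • v) - f x - k * (c * fderiv ℂ f x v)‖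
        ≤ 2 * (‖f p‖ + 1) * ‖k‖ * ‖k‖ := by
    intro x hx k hk
    have hxd : x ∈ ball p δ := ball_subset_ball (by linarith) hx
    have hder : deriv (fun k : ℂ => f (x + (k * c) • v)) 0 = c * fderiv ℂ f x v := by
      have h0 : HasFDerivAt f (fderiv ℂ f x) (x + ((0 : ℂ) * c) • v) := by
        simpa using (hf.differentiableAt (hU.mem_nhds (hsub hxd).1)).hasFDerivAt
      have := (h0.comp_hasDerivAt (0 : ℂ) (hline x 0)).deriv
      simpa [Function.comp_def] using this
    have := norm_taylor_one_sub_le (h := fun k : ℂ => f (x + (k * c) • v)) (C := ‖f p‖ + 1)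
      (hf.comp (fun k _ => (hline x k).differentiableAt.differentiableWithinAt)
        (fun k hk => (hsub (hin x hx k hk)).1))
      (fun k hk => (hsub (hin x hx k hk)).2.le) hk
    rw [hder] at this
    simpa using this
  set κ : ℕ → ℂ := fun n => ((1 / (2 * ((n : ℝ) + 1)) : ℝ) : ℂ) with hκ
  have hκpos : ∀ n : ℕ, 0 < 1 / (2 * ((n : ℝ) + 1)) := fun n => by positivity
  have hκn : ∀ n, ‖κ n‖ = 1 / (2 * ((n : ℝ) + 1)) := fun n => by
    rw [hκ, Complex.norm_real, Real.norm_eq_abs, abs_of_pos (hκpos n)]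
  have hκ0 : ∀ n, κ n ≠ 0 := fun n => by rw [← norm_pos_iff, hκn]; exact hκpos n
  have hκhalf : ∀ n, ‖κ n‖ ≤ 1 / 2 := fun n => by
    rw [hκn]
    apply one_div_le_one_div_of_le (by norm_num)
    have : (0 : ℝ) ≤ n := n.cast_nonneg
    linarith
  have key := differentiableOn_of_tendstoUniformlyOn (U := ball p (δ / 2))
    (F := fun n x => (κ n * c)⁻¹ * (f (x + (κ n * c) • v) - f x))
    (f := fun x => fderiv ℂ f x v) isOpen_ball ?_ ?_
  · exact (key.differentiableAt (isOpen_ball.mem_nhds (mem_ball_self (half_pos hδ)))).differentiableWithinAt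
  · intro n
    have hκ2 : κ n ∈ ball (0 : ℂ) 2 := by
      rw [mem_ball, dist_zero_right]; linarith [hκhalf n]
    refine DifferentiableOn.const_mul (DifferentiableOn.sub ?_ ?_) _
    · exact hf.comp ((differentiable_id.add_const _).differentiableOn)
        (fun x hx => (hsub (hin x hx _ hκ2)).1)
    · exact hf.mono fun x hx => (hsub (ball_subset_ball (by linarith) hx)).1
  · rw [Metric.tendstoUniformlyOn_iff]
    intro ε hε
    have hlim : Tendsto (fun n : ℕ => 2 * (‖f p‖ + 1) / ‖c‖ * (1 / 2 * (1 / ((n : ℝ) + 1)))) atTop (𝓝 0) := by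
      simpa only [mul_zero] using (tendsto_one_div_add_atTop_nhds_zero_nat (𝕜 := ℝ)).const_mul (1 / 2) |>.const_mul
        (2 * (‖f p‖ + 1) / ‖c‖)
    filter_upwards [hlim.eventually_lt_const hε] with n hn x hx
    rw [dist_comm, dist_eq_norm]
    have h1 := hest x hx (κ n) (hκhalf n)
    have e : (κ n * c)⁻¹ * (f (x + (κ n * c) • v) - f x) - fderiv ℂ f x v =
        (κ n * c)⁻¹ * (f (x + (κ n * c) • v) - f x - κ n * (c * fderiv ℂ f x v)) := by
      have := hκ0 n
      field_simp
    rw [e, norm_mul, norm_inv, norm_mul]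
    refine lt_of_le_of_lt ?_ hn
    have hκp : 0 < ‖κ n‖ := norm_pos_iff.2 (hκ0 n)
    have hcp : 0 < ‖c‖ := norm_pos_iff.2 hc0
    calc (‖κ n‖ * ‖c‖)⁻¹ * _ ≤ (‖κ n‖ * ‖c‖)⁻¹ * (2 * (‖f p‖ + 1) * ‖κ n‖ * ‖κ n‖) := by gcongr
      _ = 2 * (‖f p‖ + 1) / ‖c‖ * ‖κ n‖ := by field_simp
      _ = _ := by rw [hκn]; congr 1; field_simp

theorem contDiffOn_of_differentiableOn_finiteDimensional [FiniteDimensional ℂ E] {f : E → ℂ}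
    {U : Set E} (hU : IsOpen U) (hf : DifferentiableOn ℂ f U) : ContDiffOn ℂ (⊤ : ℕ∞) f U := by
  rw [contDiffOn_infty]
  intro n
  induction n generalizing f with
  | zero => exact contDiffOn_zero.2 hf.continuousOn
  | succ n ih =>
    push_cast
    rw [contDiffOn_succ_iff_fderiv_of_isOpen hU]
    exact ⟨hf, by simp, contDiffOn_clm_apply.2 fun v => ih (differentiableOn_fderiv_apply hU hf v)⟩

end Holomorphic

section Cone

open Metric Topology Set

/-- The complex cone over the disc `‖x‖ < R`, with `z`-radius shrinking from `r` to `r / 2`. -/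
def cone (R r : ℝ) (c : ℂ) : Set (ℂ × ℂ) :=
  {p | ‖p.1‖ < R ∧ ‖p.2 - c‖ < r * (1 - ‖p.1‖ / (2 * R))}

theorem isOpen_cone (R r : ℝ) (c : ℂ) : IsOpen (cone R r c) :=
  (isOpen_lt (f := fun p : ℂ × ℂ => ‖p.1‖) (g := fun _ => R) (by fun_prop) (by fun_prop)).inter
    (isOpen_lt (f := fun p : ℂ × ℂ => ‖p.2 - c‖) (g := fun p => r * (1 - ‖p.1‖ / (2 * R)))
      (by fun_prop) (by fun_prop))

theorem cone_norm_sub_lt {R r : ℝ} {c : ℂ} (hr : 0 ≤ r) {p : ℂ × ℂ} (hp : p ∈ cone R r c) :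
    ‖p.2 - c‖ < r := by
  have hR : 0 < R := (norm_nonneg _).trans_lt hp.1
  refine hp.2.trans_le ?_
  have : 0 ≤ ‖p.1‖ / (2 * R) := by positivity
  nlinarith

theorem cone_scale_mem {R r : ℝ} {c : ℂ} (hr : 0 ≤ r) {x y z : ℂ} (hp : (x, z) ∈ cone R r c)
    (hyx : ‖y‖ ≤ ‖x‖) : (y, z) ∈ cone R r c := by
  have hR : 0 < R := (norm_nonneg _).trans_lt hp.1
  refine ⟨hyx.trans_lt hp.1, hp.2.trans_le ?_⟩
  simp only
  gcongr

/-- The set `D` is stable under shrinking the first coordinate. -/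
def RayStable (D : Set (ℂ × ℂ)) : Prop :=
  ∀ x z y : ℂ, (x, z) ∈ D → ‖y‖ ≤ ‖x‖ → (y, z) ∈ D

theorem norm_ofReal_mul_le {θ : ℝ} (hθ : θ ∈ Icc (0 : ℝ) 1) (x : ℂ) : ‖(θ : ℂ) * x‖ ≤ ‖x‖ := by
  rw [norm_mul, Complex.norm_real, Real.norm_eq_abs, abs_of_nonneg hθ.1]
  exact mul_le_of_le_one_left (norm_nonneg _) hθ.2

/-- Weighted average of `w` along the segment from `(0, z)` to `(x, z)`. -/
noncomputable def rayInt (k : ℝ → ℂ) (w : ℂ × ℂ → ℂ) (p : ℂ × ℂ) : ℂ :=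
  ∫ θ in (0 : ℝ)..1, k θ * w ((θ : ℂ) * p.1, p.2)

/-- The linear map `(x, z) ↦ (θ x, z)`. -/
noncomputable def scaleFst (θ : ℝ) : ℂ × ℂ →L[ℂ] ℂ × ℂ :=
  (θ : ℂ) • (ContinuousLinearMap.inl ℂ ℂ ℂ).comp (ContinuousLinearMap.fst ℂ ℂ ℂ) +
    (ContinuousLinearMap.inr ℂ ℂ ℂ).comp (ContinuousLinearMap.snd ℂ ℂ ℂ)

theorem scaleFst_apply (θ : ℝ) (p : ℂ × ℂ) : scaleFst θ p = ((θ : ℂ) * p.1, p.2) := by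
  simp [scaleFst]

theorem continuous_scaleFst : Continuous scaleFst :=
  (Complex.continuous_ofReal.smul continuous_const).add continuous_const

variable {D : Set (ℂ × ℂ)} {w : ℂ × ℂ → ℂ} {k : ℝ → ℂ}

theorem continuousOn_ray (hD : RayStable D) (hw : ContinuousOn w D) (hk : Continuous k) {p : ℂ × ℂ}
    (hp : p ∈ D) : ContinuousOn (fun θ : ℝ => k θ * w ((θ : ℂ) * p.1, p.2)) (Icc 0 1) :=
  hk.continuousOn.mul (hw.comp (by fun_prop) fun _ hθ => hD _ _ _ hp (norm_ofReal_mul_le hθ _))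

theorem intervalIntegrable_ray (hD : RayStable D) (hw : ContinuousOn w D) (hk : Continuous k)
    {p : ℂ × ℂ} (hp : p ∈ D) :
    IntervalIntegrable (fun θ : ℝ => k θ * w ((θ : ℂ) * p.1, p.2)) MeasureTheory.volume 0 1 :=
  ContinuousOn.intervalIntegrable (by
    rw [uIcc_of_le zero_le_one]; exact continuousOn_ray hD hw hk hp)

theorem hasFDerivAt_rayInt (hDo : IsOpen D) (hD : RayStable D) (hw : DifferentiableOn ℂ w D)
    (hk : Continuous k) {p : ℂ × ℂ} (hp : p ∈ D) :
    IntervalIntegrable (fun θ : ℝ => k θ •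
        (fderiv ℂ w ((θ : ℂ) * p.1, p.2)).comp (scaleFst θ)) MeasureTheory.volume 0 1 ∧
    HasFDerivAt (rayInt k w) (∫ θ in (0 : ℝ)..1, k θ •
      (fderiv ℂ w ((θ : ℂ) * p.1, p.2)).comp (scaleFst θ)) p := by
  have hfc : ContinuousOn (fderiv ℂ w) D :=
    (contDiffOn_of_differentiableOn_finiteDimensional hDo hw).continuousOn_fderiv_of_isOpen hDo
      (by norm_num)
  obtain ⟨δ, hδ, hsub⟩ := Metric.nhds_basis_closedBall.mem_iff.1 (hDo.mem_nhds hp)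
  have hcont : ContinuousOn (fun y : ℝ × (ℂ × ℂ) => k y.1 •
      (fderiv ℂ w ((y.1 : ℂ) * y.2.1, y.2.2)).comp (scaleFst y.1)) (Icc 0 1 ×ˢ closedBall p δ) := by
    refine ContinuousOn.smul (hk.comp continuous_fst).continuousOn (ContinuousOn.clm_comp ?_
      (continuous_scaleFst.comp continuous_fst).continuousOn)
    exact hfc.comp (by fun_prop) fun y hy => hD _ _ _ (hsub hy.2) (norm_ofReal_mul_le hy.1 _)
  obtain ⟨C, hC⟩ := (isCompact_Icc.prod (isCompact_closedBall p δ)).exists_bound_of_continuousOn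
    hcont
  have hI : uIoc (0 : ℝ) 1 ⊆ Icc 0 1 := by
    rw [uIoc_of_le zero_le_one]; exact Ioc_subset_Icc_self
  have hcp : ContinuousOn (fun θ : ℝ => k θ •
        (fderiv ℂ w ((θ : ℂ) * p.1, p.2)).comp (scaleFst θ)) (Icc 0 1) :=
    hcont.comp (f := fun θ : ℝ => (θ, p)) (by fun_prop) fun θ hθ => ⟨hθ, mem_closedBall_self hδ.le⟩
  have hki : IntervalIntegrable (fun θ : ℝ => k θ •
        (fderiv ℂ w ((θ : ℂ) * p.1, p.2)).comp (scaleFst θ)) MeasureTheory.volume 0 1 :=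
    ContinuousOn.intervalIntegrable (by rwa [uIcc_of_le zero_le_one])
  refine ⟨hki, ?_⟩
  refine intervalIntegral.hasFDerivAt_integral_of_dominated_of_fderiv_le
    (F := fun p θ => k θ * w ((θ : ℂ) * p.1, p.2))
    (F' := fun p θ => k θ • (fderiv ℂ w ((θ : ℂ) * p.1, p.2)).comp (scaleFst θ))
    (bound := fun _ => C) (closedBall_mem_nhds p hδ) ?_ ?_ ?_ ?_ ?_ ?_
  · filter_upwards [closedBall_mem_nhds p hδ] with q hq
    exact (intervalIntegrable_iff.1
      (intervalIntegrable_ray hD hw.continuousOn hk (hsub hq))).aestronglyMeasurable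
  · exact intervalIntegrable_ray hD hw.continuousOn hk hp
  · exact (intervalIntegrable_iff.1 hki).aestronglyMeasurable
  · exact Eventually.of_forall fun θ hθ q hq => hC (θ, q) ⟨hI hθ, hq⟩
  · exact intervalIntegrable_const
  · refine Eventually.of_forall fun θ hθ q hq => ?_
    have hm : scaleFst θ q ∈ D := by
      rw [scaleFst_apply]; exact hD _ _ _ (hsub hq) (norm_ofReal_mul_le (hI hθ) _)
    have h1 : HasFDerivAt w (fderiv ℂ w (scaleFst θ q)) (scaleFst θ q) :=
      (hw.differentiableAt (hDo.mem_nhds hm)).hasFDerivAt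
    have h2 := (h1.comp q (scaleFst θ).hasFDerivAt).const_mul (k θ)
    simpa only [Function.comp_def, scaleFst_apply] using h2

theorem differentiableOn_rayInt (hDo : IsOpen D) (hD : RayStable D) (hw : DifferentiableOn ℂ w D)
    (hk : Continuous k) : DifferentiableOn ℂ (rayInt k w) D := fun _ hp =>
  (hasFDerivAt_rayInt hDo hD hw hk hp).2.differentiableAt.differentiableWithinAt

/-- The partial derivative in the first variable. -/
noncomputable def dFst (w : ℂ × ℂ → ℂ) (p : ℂ × ℂ) : ℂ := fderiv ℂ w p (1, 0)

/-- The partial derivative in the second variable. -/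
noncomputable def dSnd (w : ℂ × ℂ → ℂ) (p : ℂ × ℂ) : ℂ := fderiv ℂ w p (0, 1)

theorem hasDerivAt_fst {p : ℂ × ℂ} (hw : DifferentiableAt ℂ w p) :
    HasDerivAt (fun x => w (x, p.2)) (dFst w p) p.1 := by
  have h1 : HasFDerivAt w (fderiv ℂ w p) (p.1, p.2) := hw.hasFDerivAt
  exact h1.comp_hasDerivAt p.1 ((hasDerivAt_id p.1).prodMk (hasDerivAt_const p.1 p.2))

theorem hasDerivAt_snd {p : ℂ × ℂ} (hw : DifferentiableAt ℂ w p) :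
    HasDerivAt (fun z => w (p.1, z)) (dSnd w p) p.2 := by
  have h1 : HasFDerivAt w (fderiv ℂ w p) (p.1, p.2) := hw.hasFDerivAt
  exact h1.comp_hasDerivAt p.2 ((hasDerivAt_const p.2 p.1).prodMk (hasDerivAt_id p.2))

theorem dFst_rayInt (hDo : IsOpen D) (hD : RayStable D) (hw : DifferentiableOn ℂ w D)
    (hk : Continuous k) {p : ℂ × ℂ} (hp : p ∈ D) :
    dFst (rayInt k w) p = rayInt (fun θ => k θ * θ) (dFst w) p := by
  obtain ⟨h1, h2⟩ := hasFDerivAt_rayInt hDo hD hw hk hp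
  rw [dFst, h2.fderiv, ContinuousLinearMap.intervalIntegral_apply h1, rayInt]
  refine intervalIntegral.integral_congr fun θ _ => ?_
  have : ((θ : ℂ) * 1, (0 : ℂ)) = (θ : ℂ) • ((1 : ℂ), (0 : ℂ)) := by simp
  simp only [_root_.smul_apply, ContinuousLinearMap.comp_apply, scaleFst_apply, dFst]
  rw [this, map_smul]
  simp [mul_assoc]

theorem dSnd_rayInt (hDo : IsOpen D) (hD : RayStable D) (hw : DifferentiableOn ℂ w D)
    (hk : Continuous k) {p : ℂ × ℂ} (hp : p ∈ D) :
    dSnd (rayInt k w) p = rayInt k (dSnd w) p := by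
  obtain ⟨h1, h2⟩ := hasFDerivAt_rayInt hDo hD hw hk hp
  rw [dSnd, h2.fderiv, ContinuousLinearMap.intervalIntegral_apply h1, rayInt]
  refine intervalIntegral.integral_congr fun θ _ => ?_
  simp [ContinuousLinearMap.comp_apply, scaleFst_apply, dSnd]

/-- The primitive of `w` in the first variable vanishing at `x = 0`. -/
noncomputable def prim (w : ℂ × ℂ → ℂ) (p : ℂ × ℂ) : ℂ := p.1 * rayInt (fun _ => 1) w p

/-- The second primitive of `w` in the first variable vanishing to second order at `x = 0`. -/
noncomputable def prim₂ (w : ℂ × ℂ → ℂ) (p : ℂ × ℂ) : ℂ :=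
  p.1 ^ 2 * rayInt (fun θ => 1 - (θ : ℂ)) w p

theorem continuous_one_sub_ofReal : Continuous fun θ : ℝ => 1 - (θ : ℂ) := by fun_prop

theorem differentiableOn_prim (hDo : IsOpen D) (hD : RayStable D) (hw : DifferentiableOn ℂ w D) :
    DifferentiableOn ℂ (prim w) D :=
  differentiable_fst.differentiableOn.mul (differentiableOn_rayInt hDo hD hw continuous_const)

theorem differentiableOn_prim₂ (hDo : IsOpen D) (hD : RayStable D) (hw : DifferentiableOn ℂ w D) :
    DifferentiableOn ℂ (prim₂ w) D :=
  (differentiable_fst.pow 2).differentiableOn.mul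
    (differentiableOn_rayInt hDo hD hw continuous_one_sub_ofReal)

theorem hasDerivAt_ray (hDo : IsOpen D) (hD : RayStable D) (hw : DifferentiableOn ℂ w D)
    {p : ℂ × ℂ} (hp : p ∈ D) {θ : ℝ} (hθ : θ ∈ Icc (0 : ℝ) 1) :
    HasDerivAt (fun θ : ℝ => w ((θ : ℂ) * p.1, p.2))
      (p.1 * dFst w ((θ : ℂ) * p.1, p.2)) θ := by
  have hm : ((θ : ℂ) * p.1, p.2) ∈ D := hD _ _ _ hp (norm_ofReal_mul_le hθ _)
  have h1 := hasDerivAt_fst (hw.differentiableAt (hDo.mem_nhds hm))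
  have h2 : HasDerivAt (fun θ : ℝ => (θ : ℂ) * p.1) p.1 θ := by
    simpa using (Complex.ofRealCLM.hasDerivAt (x := θ)).mul_const p.1
  have := h1.comp θ h2
  rw [mul_comm]
  exact this

theorem hasDerivAt_prim (hDo : IsOpen D) (hD : RayStable D) (hw : DifferentiableOn ℂ w D)
    {p : ℂ × ℂ} (hp : p ∈ D) : HasDerivAt (fun x => prim w (x, p.2)) (w p) p.1 := by
  have hdw : DifferentiableOn ℂ (dFst w) D := differentiableOn_fderiv_apply hDo hw _
  have h1 := hasDerivAt_fst ((differentiableOn_rayInt hDo hD hw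
    (continuous_const (y := (1 : ℂ)))).differentiableAt (hDo.mem_nhds hp))
  rw [dFst_rayInt hDo hD hw continuous_const hp] at h1
  have h2 := (hasDerivAt_id p.1).mul h1
  refine h2.congr_deriv ?_
  have hi1 := intervalIntegrable_ray hD hw.continuousOn (continuous_const (y := (1 : ℂ))) hp
  have hi2 := intervalIntegrable_ray hD hdw.continuousOn (k := fun θ => 1 * (θ : ℂ))
    (by fun_prop) hp
  have key : ∫ θ in (0 : ℝ)..1, (1 * w ((θ : ℂ) * p.1, p.2) +
      p.1 * (1 * (θ : ℂ) * dFst w ((θ : ℂ) * p.1, p.2))) = w p := by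
    have := intervalIntegral.integral_eq_sub_of_hasDerivAt (a := 0) (b := 1)
      (f := fun θ : ℝ => (θ : ℂ) * w ((θ : ℂ) * p.1, p.2))
      (f' := fun θ : ℝ => 1 * w ((θ : ℂ) * p.1, p.2) +
        p.1 * (1 * (θ : ℂ) * dFst w ((θ : ℂ) * p.1, p.2))) (fun θ hθ => by
          rw [uIcc_of_le zero_le_one] at hθ
          refine ((Complex.ofRealCLM.hasDerivAt (x := θ)).mul
            (hasDerivAt_ray hDo hD hw hp hθ)).congr_deriv ?_
          simp
          ring) (hi1.add (hi2.const_mul p.1))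
    simpa using this
  rw [intervalIntegral.integral_add hi1 (hi2.const_mul p.1),
    intervalIntegral.integral_const_mul] at key
  simpa [rayInt] using key

theorem hasDerivAt_prim₂ (hDo : IsOpen D) (hD : RayStable D) (hw : DifferentiableOn ℂ w D)
    {p : ℂ × ℂ} (hp : p ∈ D) : HasDerivAt (fun x => prim₂ w (x, p.2)) (prim w p) p.1 := by
  have hdw : DifferentiableOn ℂ (dFst w) D := differentiableOn_fderiv_apply hDo hw _
  have h1 := hasDerivAt_fst ((differentiableOn_rayInt hDo hD hw
    continuous_one_sub_ofReal).differentiableAt (hDo.mem_nhds hp))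
  rw [dFst_rayInt hDo hD hw continuous_one_sub_ofReal hp] at h1
  have h2 := ((hasDerivAt_id p.1).pow 2).mul h1
  refine h2.congr_deriv ?_
  have hi0 := intervalIntegrable_ray hD hw.continuousOn (continuous_const (y := (1 : ℂ))) hp
  have hi1 := intervalIntegrable_ray hD hw.continuousOn continuous_one_sub_ofReal hp
  have hi2 := intervalIntegrable_ray hD hdw.continuousOn (k := fun θ => (1 - (θ : ℂ)) * (θ : ℂ))
    (by fun_prop) hp
  have key : ∫ θ in (0 : ℝ)..1, (2 * ((1 - (θ : ℂ)) * w ((θ : ℂ) * p.1, p.2)) +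
      p.1 * ((1 - (θ : ℂ)) * (θ : ℂ) * dFst w ((θ : ℂ) * p.1, p.2)) -
      1 * w ((θ : ℂ) * p.1, p.2)) = 0 := by
    have := intervalIntegral.integral_eq_sub_of_hasDerivAt (a := 0) (b := 1)
      (f := fun θ : ℝ => ((1 - (θ : ℂ)) * (θ : ℂ)) * w ((θ : ℂ) * p.1, p.2))
      (f' := fun θ : ℝ => 2 * ((1 - (θ : ℂ)) * w ((θ : ℂ) * p.1, p.2)) +
        p.1 * ((1 - (θ : ℂ)) * (θ : ℂ) * dFst w ((θ : ℂ) * p.1, p.2)) -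
        1 * w ((θ : ℂ) * p.1, p.2)) (fun θ hθ => by
          rw [uIcc_of_le zero_le_one] at hθ
          have hid : HasDerivAt (fun θ : ℝ => (θ : ℂ)) 1 θ := Complex.ofRealCLM.hasDerivAt (x := θ)
          refine (((hid.const_sub 1).mul hid).mul
            (hasDerivAt_ray hDo hD hw hp hθ)).congr_deriv ?_
          simp only [Pi.mul_apply]
          ring) (((hi1.const_mul 2).add (hi2.const_mul p.1)).sub hi0)
    simpa using this
  rw [intervalIntegral.integral_sub ((hi1.const_mul 2).add (hi2.const_mul p.1)) hi0,
    intervalIntegral.integral_add (hi1.const_mul 2) (hi2.const_mul p.1),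
    intervalIntegral.integral_const_mul, intervalIntegral.integral_const_mul] at key
  have e := eq_of_sub_eq_zero key
  simp only [prim, rayInt] at e ⊢
  rw [← e]
  simp only [id, Pi.pow_apply]
  push_cast
  ring

theorem hasDerivAt_prim₂_snd (hDo : IsOpen D) (hD : RayStable D) (hw : DifferentiableOn ℂ w D)
    {p : ℂ × ℂ} (hp : p ∈ D) :
    HasDerivAt (fun z => prim₂ w (p.1, z)) (prim₂ (dSnd w) p) p.2 := by
  have h1 := hasDerivAt_snd ((differentiableOn_rayInt hDo hD hw
    continuous_one_sub_ofReal).differentiableAt (hDo.mem_nhds hp))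
  rw [dSnd_rayInt hDo hD hw continuous_one_sub_ofReal hp] at h1
  exact h1.const_mul (p.1 ^ 2)

end Cone

section Bounds

open Metric Topology Set

variable {D : Set (ℂ × ℂ)} {w w₁ w₂ : ℂ × ℂ → ℂ} {k : ℝ → ℂ}

theorem rayInt_congr (hD : RayStable D) (h : EqOn w₁ w₂ D) {p : ℂ × ℂ} (hp : p ∈ D) :
    rayInt k w₁ p = rayInt k w₂ p := by
  refine intervalIntegral.integral_congr fun θ hθ => ?_
  rw [uIcc_of_le zero_le_one] at hθ
  exact congrArg (k θ * ·) (h (hD _ _ _ hp (norm_ofReal_mul_le hθ _)))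

theorem rayInt_sub (hD : RayStable D) (h₁ : ContinuousOn w₁ D) (h₂ : ContinuousOn w₂ D)
    (hk : Continuous k) {p : ℂ × ℂ} (hp : p ∈ D) :
    rayInt k (fun p => w₁ p - w₂ p) p = rayInt k w₁ p - rayInt k w₂ p := by
  rw [rayInt, rayInt, rayInt, ← intervalIntegral.integral_sub
    (intervalIntegrable_ray hD h₁ hk hp) (intervalIntegrable_ray hD h₂ hk hp)]
  simp only [mul_sub]

theorem prim_sub (hD : RayStable D) (h₁ : ContinuousOn w₁ D) (h₂ : ContinuousOn w₂ D)
    {p : ℂ × ℂ} (hp : p ∈ D) : prim (fun p => w₁ p - w₂ p) p = prim w₁ p - prim w₂ p := by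
  rw [prim, rayInt_sub hD h₁ h₂ continuous_const hp, mul_sub, prim, prim]

theorem prim₂_sub (hD : RayStable D) (h₁ : ContinuousOn w₁ D) (h₂ : ContinuousOn w₂ D)
    {p : ℂ × ℂ} (hp : p ∈ D) : prim₂ (fun p => w₁ p - w₂ p) p = prim₂ w₁ p - prim₂ w₂ p := by
  rw [prim₂, rayInt_sub hD h₁ h₂ continuous_one_sub_ofReal hp, mul_sub, prim₂, prim₂]

theorem differentiableOn_dSnd (hDo : IsOpen D) (hw : DifferentiableOn ℂ w D) :
    DifferentiableOn ℂ (dSnd w) D := differentiableOn_fderiv_apply hDo hw _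

theorem prim₂_dSnd_sub (hDo : IsOpen D) (hD : RayStable D) (h₁ : DifferentiableOn ℂ w₁ D)
    (h₂ : DifferentiableOn ℂ w₂ D) {p : ℂ × ℂ} (hp : p ∈ D) :
    prim₂ (dSnd fun p => w₁ p - w₂ p) p = prim₂ (dSnd w₁) p - prim₂ (dSnd w₂) p := by
  rw [← prim₂_sub hD (differentiableOn_dSnd hDo h₁).continuousOn
    (differentiableOn_dSnd hDo h₂).continuousOn hp, prim₂, prim₂]
  rw [rayInt_congr hD (fun q hq => ?_) hp]
  have e : fderiv ℂ (fun p => w₁ p - w₂ p) q = fderiv ℂ w₁ q - fderiv ℂ w₂ q :=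
    fderiv_sub (h₁.differentiableAt (hDo.mem_nhds hq)) (h₂.differentiableAt (hDo.mem_nhds hq))
  simp [dSnd, e]

variable {R r K C : ℝ} {c : ℂ}

theorem rayStable_cone (hr : 0 ≤ r) : RayStable (cone R r c) := fun _ _ _ hp h =>
  cone_scale_mem hr hp h

theorem norm_rayInt_le (hr : 0 ≤ r) (hK : 0 ≤ K)
    (hw : ∀ q ∈ cone R r c, ‖w q‖ ≤ C * Real.exp (K * ‖q.1‖))
    (hk : ∀ θ ∈ Icc (0 : ℝ) 1, ‖k θ‖ ≤ 1) {p : ℂ × ℂ} (hp : p ∈ cone R r c) :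
    ‖rayInt k w p‖ ≤ C * Real.exp (K * ‖p.1‖) := by
  have hC : 0 ≤ C := by
    have := (norm_nonneg _).trans (hw p hp)
    exact nonneg_of_mul_nonneg_left this (Real.exp_pos _)
  have := intervalIntegral.norm_integral_le_of_norm_le_const (a := 0) (b := 1)
    (f := fun θ : ℝ => k θ * w ((θ : ℂ) * p.1, p.2)) (C := C * Real.exp (K * ‖p.1‖))
    (fun θ hθ => by
      rw [uIoc_of_le zero_le_one] at hθ
      have hθ' : θ ∈ Icc (0 : ℝ) 1 := Ioc_subset_Icc_self hθ
      rw [norm_mul]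
      have h1 := hw _ (rayStable_cone hr _ _ _ hp (norm_ofReal_mul_le hθ' p.1))
      have h2 : C * Real.exp (K * ‖(θ : ℂ) * p.1‖) ≤ C * Real.exp (K * ‖p.1‖) := by
        gcongr
        exact norm_ofReal_mul_le hθ' p.1
      calc ‖k θ‖ * ‖w ((θ : ℂ) * p.1, p.2)‖ ≤ 1 * (C * Real.exp (K * ‖p.1‖)) :=
            mul_le_mul (hk θ hθ') (h1.trans h2) (norm_nonneg _) zero_le_one
        _ = _ := one_mul _)
  simpa [rayInt] using this

theorem norm_prim_le (hr : 0 ≤ r) (hK : 0 ≤ K)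
    (hw : ∀ q ∈ cone R r c, ‖w q‖ ≤ C * Real.exp (K * ‖q.1‖)) {p : ℂ × ℂ} (hp : p ∈ cone R r c) :
    ‖prim w p‖ ≤ R * (C * Real.exp (K * ‖p.1‖)) := by
  rw [prim, norm_mul]
  exact mul_le_mul hp.1.le (norm_rayInt_le hr hK hw (by simp) hp) (norm_nonneg _)
    ((norm_nonneg _).trans hp.1.le)

theorem norm_one_sub_ofReal {θ : ℝ} (hθ : θ ∈ Icc (0 : ℝ) 1) : ‖1 - (θ : ℂ)‖ = 1 - θ := by
  have : (1 - (θ : ℂ)) = ((1 - θ : ℝ) : ℂ) := by push_cast; ring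
  rw [this, Complex.norm_real, Real.norm_eq_abs, abs_of_nonneg (by linarith [hθ.2])]

theorem norm_prim₂_le (hr : 0 ≤ r) (hK : 0 ≤ K)
    (hw : ∀ q ∈ cone R r c, ‖w q‖ ≤ C * Real.exp (K * ‖q.1‖)) {p : ℂ × ℂ} (hp : p ∈ cone R r c) :
    ‖prim₂ w p‖ ≤ R ^ 2 * (C * Real.exp (K * ‖p.1‖)) := by
  rw [prim₂, norm_mul, norm_pow]
  refine mul_le_mul (pow_le_pow_left₀ (norm_nonneg _) hp.1.le 2) (norm_rayInt_le hr hK hw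
    (fun θ hθ => ?_) hp) (norm_nonneg _) (by positivity)
  rw [norm_one_sub_ofReal hθ]
  linarith [hθ.1]

/-- The smoothing of a `z`-derivative by two `x`-integrations, in the exponentially weighted norm
over a cone: the Cauchy estimate loses exactly one factor of the distance to the vertex. -/
theorem norm_prim₂_dSnd_le (hDo : IsOpen D) (hw : DifferentiableOn ℂ w D)
    (hsub : cone R r c ⊆ D) (hr : 0 < r) (hK : 0 < K)
    (hC : ∀ q ∈ cone R r c, ‖w q‖ ≤ C * Real.exp (K * ‖q.1‖)) {p : ℂ × ℂ} (hp : p ∈ cone R r c) :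
    ‖prim₂ (dSnd w) p‖ ≤ 2 * R / (r * K) * (C * Real.exp (K * ‖p.1‖)) := by
  have hC0 : 0 ≤ C :=
    nonneg_of_mul_nonneg_left ((norm_nonneg _).trans (hC p hp)) (Real.exp_pos _)
  have hR : 0 < R := (norm_nonneg _).trans_lt hp.1
  rcases eq_or_ne p.1 0 with h0 | h0
  · simp only [prim₂, h0]
    simp only [ne_eq, OfNat.ofNat_ne_zero, not_false_eq_true, zero_pow, zero_mul, norm_zero]
    positivity
  have hx : 0 < ‖p.1‖ := norm_pos_iff.2 h0
  have hpt : ∀ θ ∈ Ioc (0 : ℝ) 1, ‖(1 - (θ : ℂ)) * dSnd w ((θ : ℂ) * p.1, p.2)‖ ≤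
      2 * R / (r * ‖p.1‖) * C * Real.exp (K * ‖p.1‖ * θ) := by
    intro θ hθ
    have hθ' : θ ∈ Icc (0 : ℝ) 1 := Ioc_subset_Icc_self hθ
    rw [norm_mul, norm_one_sub_ofReal hθ']
    rcases hθ.2.eq_or_lt with rfl | hlt
    · simp only [sub_self, zero_mul]; positivity
    have h1θ : 0 < 1 - θ := by linarith
    set ρ : ℝ := r * ((1 - θ) * ‖p.1‖ / (2 * R)) with hρ
    have hρ0 : 0 < ρ := by positivity
    have hnx : ‖(θ : ℂ) * p.1‖ = θ * ‖p.1‖ := by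
      rw [norm_mul, Complex.norm_real, Real.norm_eq_abs, abs_of_pos hθ.1]
    have hmem : ∀ ζ ∈ closedBall p.2 ρ, ((θ : ℂ) * p.1, ζ) ∈ cone R r c := by
      intro ζ hζ
      refine ⟨(norm_ofReal_mul_le hθ' _).trans_lt hp.1, ?_⟩
      rw [mem_closedBall, dist_eq_norm] at hζ
      have : ‖ζ - c‖ ≤ ‖ζ - p.2‖ + ‖p.2 - c‖ := norm_sub_le_norm_sub_add_norm_sub _ _ _
      have h2 := hp.2
      simp only [hnx]
      have h3 : r * (1 - θ * ‖p.1‖ / (2 * R)) = r * (1 - ‖p.1‖ / (2 * R)) + ρ := by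
        rw [hρ]; field_simp; ring
      rw [h3]; linarith
    have hdiff : DifferentiableOn ℂ (fun ζ => w ((θ : ℂ) * p.1, ζ)) (closedBall p.2 ρ) :=
      hw.comp (by fun_prop) fun ζ hζ => hsub (hmem ζ hζ)
    have hcau := Complex.norm_deriv_le_of_forall_mem_sphere_norm_le
      (C := C * Real.exp (K * ‖(θ : ℂ) * p.1‖)) hρ0
      (hdiff.diffContOnCl_ball subset_rfl)
      (fun ζ hζ => hC _ (hmem ζ (sphere_subset_closedBall hζ)))
    have hder := hasDerivAt_snd (p := ((θ : ℂ) * p.1, p.2)) (hw.differentiableAt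
      (hDo.mem_nhds (hsub (hmem p.2 (mem_closedBall_self hρ0.le)))))
    rw [hder.deriv] at hcau
    calc (1 - θ) * ‖dSnd w ((θ : ℂ) * p.1, p.2)‖
        ≤ (1 - θ) * (C * Real.exp (K * ‖(θ : ℂ) * p.1‖) / ρ) := by gcongr
      _ = _ := by
        rw [hnx, hρ, show K * (θ * ‖p.1‖) = K * ‖p.1‖ * θ by ring]
        field_simp
  have hKx : K * ‖p.1‖ ≠ 0 := by positivity
  have hki : ∫ θ in (0 : ℝ)..1, 2 * R / (r * ‖p.1‖) * C * Real.exp (K * ‖p.1‖ * θ) =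
      2 * R / (r * ‖p.1‖) * C * ((Real.exp (K * ‖p.1‖) - 1) / (K * ‖p.1‖)) := by
    rw [intervalIntegral.integral_const_mul, intervalIntegral.integral_comp_mul_left
      (f := Real.exp) hKx, integral_exp]
    simp [div_eq_inv_mul]
  have hle := intervalIntegral.norm_integral_le_of_norm_le (μ := MeasureTheory.volume)
    (zero_le_one' ℝ)
    (Eventually.of_forall (p := fun θ => θ ∈ Ioc (0 : ℝ) 1 →
      ‖(1 - (θ : ℂ)) * dSnd w ((θ : ℂ) * p.1, p.2)‖ ≤
      2 * R / (r * ‖p.1‖) * C * Real.exp (K * ‖p.1‖ * θ)) hpt)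
    (Continuous.intervalIntegrable (by fun_prop) 0 1)
  rw [hki] at hle
  rw [prim₂, norm_mul, norm_pow, rayInt]
  calc ‖p.1‖ ^ 2 * _ ≤ ‖p.1‖ ^ 2 * (2 * R / (r * ‖p.1‖) * C *
        ((Real.exp (K * ‖p.1‖) - 1) / (K * ‖p.1‖))) := by gcongr
    _ ≤ ‖p.1‖ ^ 2 * (2 * R / (r * ‖p.1‖) * C * (Real.exp (K * ‖p.1‖) / (K * ‖p.1‖))) := by
        gcongr; linarith
    _ = _ := by field_simp

end Bounds

section Solver

open Metric Topology Set

/-- The union of the cones with vertices on the real set `S`. -/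
def coneUnion (S : Set ℝ) (R r : ℝ → ℝ) : Set (ℂ × ℂ) := {p | ∃ t ∈ S, p ∈ cone (R t) (r t) t}

/-- The values of a function at real points of `D` are real. -/
def RealOn (D : Set (ℂ × ℂ)) (w : ℂ × ℂ → ℂ) : Prop :=
  ∀ x t : ℝ, ((x : ℂ), (t : ℂ)) ∈ D → (w (x, t)).im = 0

/-- The jet `(u, u_x, u_xx)` of `u = f + prim₂ w`. -/
noncomputable def jet (f : ℂ → ℂ) (w : ℂ × ℂ → ℂ) (p : ℂ × ℂ) : Fin 3 → ℂ :=
  ![f p.2 + prim₂ w p, prim w p, w p]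

/-- The map whose fixed points `w` are the second `x`-derivatives of the solutions
`u = f + prim₂ w` of `u_z + u_xx = F(z, u, u_x, u_xx)`. -/
noncomputable def cauchyStep (f : ℂ → ℂ) (F : ℂ → (Fin 3 → ℂ) → ℂ) (w : ℂ × ℂ → ℂ) (p : ℂ × ℂ) :
    ℂ := -deriv f p.2 - prim₂ (dSnd w) p + F p.2 (jet f w p)

/-- Cauchy data `f` and a nonlinearity `F`, controlled on discs centred at the points of `S` well
enough for `cauchyStep` to be a contraction. -/
structure CauchyData (S : Set ℝ) (R r M B κ : ℝ → ℝ) (f : ℂ → ℂ) (F : ℂ → (Fin 3 → ℂ) → ℂ) :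
    Prop where
  one_le_R : ∀ t ∈ S, 1 ≤ R t
  r_pos : ∀ t ∈ S, 0 < r t
  diff_f : ∀ t ∈ S, DifferentiableOn ℂ f (ball (t : ℂ) (r t))
  norm_f : ∀ t ∈ S, ∀ z ∈ ball (t : ℂ) (r t), ‖f z‖ ≤ M t
  norm_deriv_f : ∀ t ∈ S, ∀ z ∈ ball (t : ℂ) (r t), ‖deriv f z‖ ≤ M t
  diff_F : DifferentiableOn ℂ (fun p : ℂ × (Fin 3 → ℂ) => F p.1 p.2)
    {p | ∃ t ∈ S, p.1 ∈ ball (t : ℂ) (r t) ∧ ‖p.2‖ < B t}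
  lip_F : ∀ t ∈ S, ∀ z ∈ ball (t : ℂ) (r t), ∀ Y Y', ‖Y‖ < B t → ‖Y'‖ < B t →
    ‖F z Y - F z Y'‖ ≤ κ t * ‖Y - Y'‖
  F_zero : ∀ t ∈ S, ∀ z ∈ ball (t : ℂ) (r t), F z 0 = 0
  κ_nonneg : ∀ t ∈ S, 0 ≤ κ t
  κ_le : ∀ t ∈ S, κ t * R t ^ 2 ≤ 1 / 4
  lt_B : ∀ t ∈ S, M t + 3 * R t ^ 2 * M t * Real.exp (8 * R t / r t * R t) < B t
  real_f : ∀ t ∈ S, ∀ x : ℝ, (x : ℂ) ∈ ball (t : ℂ) (r t) → (f x).im = 0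
  real_F : ∀ t ∈ S, ∀ x : ℝ, (x : ℂ) ∈ ball (t : ℂ) (r t) → ∀ Y, ‖Y‖ < B t →
    (∀ i, (Y i).im = 0) → (F x Y).im = 0

variable {S : Set ℝ} {R r M B κ : ℝ → ℝ} {f : ℂ → ℂ} {F : ℂ → (Fin 3 → ℂ) → ℂ}
  {w w₁ w₂ : ℂ × ℂ → ℂ} {D : Set (ℂ × ℂ)}

theorem isOpen_coneUnion (S : Set ℝ) (R r : ℝ → ℝ) : IsOpen (coneUnion S R r) := by
  have : coneUnion S R r = ⋃ t ∈ S, cone (R t) (r t) t := by ext; simp [coneUnion]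
  rw [this]
  exact isOpen_biUnion fun t _ => isOpen_cone _ _ _

theorem RealOn.rayInt (hD : RayStable D) (hw : RealOn D w) (hwc : ContinuousOn w D) {k : ℝ → ℂ}
    (hk : ∀ θ, (k θ).im = 0) (hkc : Continuous k) : RealOn D (rayInt k w) := by
  intro x t hp
  have h1 := Complex.imCLM.intervalIntegral_comp_comm (intervalIntegrable_ray hD hwc hkc hp)
  have h2 : ∀ θ ∈ uIcc (0 : ℝ) 1, Complex.imCLM (k θ * w ((θ : ℂ) * x, t)) = 0 := by
    intro θ hθ
    rw [uIcc_of_le zero_le_one] at hθ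
    have := hw (θ * x) t (by
      push_cast
      exact hD _ _ _ hp (norm_ofReal_mul_le hθ _))
    push_cast at this
    simp [hk, this]
  rw [intervalIntegral.integral_congr (g := fun _ => 0) h2] at h1
  simpa [_root_.rayInt] using h1.symm

theorem RealOn.prim (hD : RayStable D) (hw : RealOn D w) (hwc : ContinuousOn w D) :
    RealOn D (prim w) := by
  intro x t hp
  simp [_root_.prim, hw.rayInt hD hwc (k := fun _ => 1) (by simp) continuous_const x t hp]

theorem RealOn.prim₂ (hD : RayStable D) (hw : RealOn D w) (hwc : ContinuousOn w D) :
    RealOn D (prim₂ w) := by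
  intro x t hp
  have h1 := hw.rayInt hD hwc (k := fun θ => 1 - (θ : ℂ)) (by simp) (by fun_prop) x t hp
  have h2 : ((x : ℂ) ^ 2).im = 0 := by rw [← Complex.ofReal_pow]; exact Complex.ofReal_im _
  simp [_root_.prim₂, h1, h2]

theorem im_eq_zero_of_hasDerivAt {g : ℂ → ℂ} {g' : ℂ} {t : ℝ} (hg : HasDerivAt g g' t)
    (h : ∀ᶠ τ : ℝ in 𝓝 t, (g τ).im = 0) : g'.im = 0 := by
  have h1 : HasDerivAt (fun τ : ℝ => (g τ).im) g'.im t := by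
    have := hg.comp_ofReal
    exact Complex.imCLM.hasFDerivAt.comp_hasDerivAt t this
  exact h1.unique ((hasDerivAt_const t (0 : ℝ)).congr_of_eventuallyEq h)

theorem RealOn.dSnd (hDo : IsOpen D) (hw : RealOn D w) (hwd : DifferentiableOn ℂ w D) :
    RealOn D (dSnd w) := by
  intro x t hp
  refine im_eq_zero_of_hasDerivAt (hasDerivAt_snd (hwd.differentiableAt (hDo.mem_nhds hp))) ?_
  have hc : Continuous fun τ : ℝ => ((x : ℂ), (τ : ℂ)) := by fun_prop
  filter_upwards [hc.continuousAt.preimage_mem_nhds (hDo.mem_nhds hp)] with τ hτ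
  exact hw x τ hτ

namespace CauchyData


theorem M_nonneg (h : CauchyData S R r M B κ f F) {t : ℝ} (ht : t ∈ S) : 0 ≤ M t :=
  (norm_nonneg _).trans (h.norm_f t ht t (mem_ball_self (h.r_pos t ht)))

theorem rayStable (h : CauchyData S R r M B κ f F) : RayStable (coneUnion S R r) :=
  fun _ _ _ ⟨t, ht, hp⟩ hle => ⟨t, ht, cone_scale_mem (h.r_pos t ht).le hp hle⟩

theorem mem_ball (h : CauchyData S R r M B κ f F) {t : ℝ} (ht : t ∈ S) {p : ℂ × ℂ}
    (hp : p ∈ cone (R t) (r t) t) : p.2 ∈ ball (t : ℂ) (r t) := by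
  rw [mem_ball_iff_norm]; exact cone_norm_sub_lt (h.r_pos t ht).le hp

theorem K_pos (h : CauchyData S R r M B κ f F) {t : ℝ} (ht : t ∈ S) : 0 < 8 * R t / r t := by
  have := h.one_le_R t ht
  have := h.r_pos t ht
  positivity

theorem norm_jet_sub_le (h : CauchyData S R r M B κ f F) (hw₁ : ContinuousOn w₁ (coneUnion S R r))
    (hw₂ : ContinuousOn w₂ (coneUnion S R r)) {t : ℝ} (ht : t ∈ S) {C : ℝ}
    (hC : ∀ q ∈ cone (R t) (r t) t, ‖w₁ q - w₂ q‖ ≤ C * Real.exp (8 * R t / r t * ‖q.1‖))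
    {p : ℂ × ℂ} (hp : p ∈ cone (R t) (r t) t) :
    ‖jet f w₁ p - jet f w₂ p‖ ≤ R t ^ 2 * (C * Real.exp (8 * R t / r t * ‖p.1‖)) := by
  have hpD : p ∈ coneUnion S R r := ⟨t, ht, hp⟩
  have hR := h.one_le_R t ht
  have hr := (h.r_pos t ht).le
  have hK := (h.K_pos ht).le
  have h0 : 0 ≤ C * Real.exp (8 * R t / r t * ‖p.1‖) := (norm_nonneg _).trans (hC p hp)
  have h1 := norm_prim₂_le hr hK hC hp
  have h2 := norm_prim_le hr hK hC hp
  rw [prim₂_sub h.rayStable hw₁ hw₂ hpD] at h1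
  rw [prim_sub h.rayStable hw₁ hw₂ hpD] at h2
  rw [pi_norm_le_iff_of_nonneg (by positivity)]
  intro i
  fin_cases i
  · simpa [jet] using h1
  · refine (le_of_eq ?_).trans (h2.trans ?_)
    · simp [jet]
    · gcongr; nlinarith
  · refine (le_of_eq ?_).trans ((hC p hp).trans ?_)
    · simp [jet]
    · exact le_mul_of_one_le_left h0 (by nlinarith)

theorem prim_zero : prim (fun _ => 0) = fun _ => 0 := by ext p; simp [prim, rayInt]

theorem prim₂_zero : prim₂ (fun _ => 0) = fun _ => 0 := by ext p; simp [prim₂, rayInt]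

theorem norm_jet_zero_le (p : ℂ × ℂ) : ‖jet f (fun _ => 0) p‖ ≤ ‖f p.2‖ := by
  rw [pi_norm_le_iff_of_nonneg (norm_nonneg _)]
  intro i
  fin_cases i <;> simp [jet, prim_zero, prim₂_zero]

theorem norm_jet_lt (h : CauchyData S R r M B κ f F) (hw : ContinuousOn w (coneUnion S R r))
    {t : ℝ} (ht : t ∈ S)
    (hC : ∀ q ∈ cone (R t) (r t) t, ‖w q‖ ≤ 3 * M t * Real.exp (8 * R t / r t * ‖q.1‖))
    {p : ℂ × ℂ} (hp : p ∈ cone (R t) (r t) t) : ‖jet f w p‖ < B t := by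
  have h1 := h.norm_jet_sub_le (w₂ := fun _ => 0) hw continuousOn_const ht (C := 3 * M t)
    (by simpa using hC) hp
  have h2 := (norm_jet_zero_le (f := f) p).trans (h.norm_f t ht _ (h.mem_ball ht hp))
  have h3 := norm_le_norm_add_norm_sub' (jet f w p) (jet f (fun _ => 0) p)
  have h4 : Real.exp (8 * R t / r t * ‖p.1‖) ≤ Real.exp (8 * R t / r t * R t) := by
    have := (h.K_pos ht).le
    gcongr
    exact hp.1.le
  have h5 := h.lt_B t ht
  have h6 : R t ^ 2 * (3 * M t * Real.exp (8 * R t / r t * ‖p.1‖)) ≤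
      3 * R t ^ 2 * M t * Real.exp (8 * R t / r t * R t) := by
    have := h.M_nonneg ht
    calc _ ≤ R t ^ 2 * (3 * M t * Real.exp (8 * R t / r t * R t)) := by gcongr
      _ = _ := by ring
  linarith

/-- The functions among which the fixed point of `cauchyStep` is sought. -/
structure Good (S : Set ℝ) (R r M : ℝ → ℝ) (w : ℂ × ℂ → ℂ) : Prop where
  diff : DifferentiableOn ℂ w (coneUnion S R r)
  bound : ∀ t ∈ S, ∀ q ∈ cone (R t) (r t) t,
    ‖w q‖ ≤ 3 * M t * Real.exp (8 * R t / r t * ‖q.1‖)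

theorem norm_cauchyStep_sub_le (h : CauchyData S R r M B κ f F) (h₁ : Good S R r M w₁)
    (h₂ : Good S R r M w₂) {t : ℝ} (ht : t ∈ S) {C : ℝ}
    (hC : ∀ q ∈ cone (R t) (r t) t, ‖w₁ q - w₂ q‖ ≤ C * Real.exp (8 * R t / r t * ‖q.1‖))
    {p : ℂ × ℂ} (hp : p ∈ cone (R t) (r t) t) :
    ‖cauchyStep f F w₁ p - cauchyStep f F w₂ p‖ ≤
      1 / 2 * C * Real.exp (8 * R t / r t * ‖p.1‖) := by
  have hpD : p ∈ coneUnion S R r := ⟨t, ht, hp⟩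
  have hR := h.one_le_R t ht
  have hr := h.r_pos t ht
  have hDo := isOpen_coneUnion S R r
  have h0 : 0 ≤ C * Real.exp (8 * R t / r t * ‖p.1‖) := (norm_nonneg _).trans (hC p hp)
  have hjet := h.norm_jet_sub_le h₁.diff.continuousOn h₂.diff.continuousOn ht hC hp
  have hF := h.lip_F t ht _ (h.mem_ball ht hp) _ _
    (h.norm_jet_lt h₁.diff.continuousOn ht (h₁.bound t ht) hp)
    (h.norm_jet_lt h₂.diff.continuousOn ht (h₂.bound t ht) hp)
  have hF2 : ‖F p.2 (jet f w₁ p) - F p.2 (jet f w₂ p)‖ ≤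
      1 / 4 * (C * Real.exp (8 * R t / r t * ‖p.1‖)) := by
    refine hF.trans ((mul_le_mul_of_nonneg_left hjet (h.κ_nonneg t ht)).trans ?_)
    rw [← mul_assoc]
    exact mul_le_mul_of_nonneg_right (h.κ_le t ht) h0
  have hd := norm_prim₂_dSnd_le hDo (h₁.diff.sub h₂.diff) (fun q hq => ⟨t, ht, hq⟩) hr
    (h.K_pos ht) hC hp
  have he : 2 * R t / (r t * (8 * R t / r t)) = 1 / 4 := by field_simp; norm_num
  rw [he] at hd
  have hs := prim₂_dSnd_sub hDo h.rayStable h₁.diff h₂.diff hpD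
  have hd' : ‖prim₂ (dSnd w₁) p - prim₂ (dSnd w₂) p‖ ≤
      1 / 4 * (C * Real.exp (8 * R t / r t * ‖p.1‖)) := by
    rw [← hs]; exact hd
  have e : cauchyStep f F w₁ p - cauchyStep f F w₂ p =
      (F p.2 (jet f w₁ p) - F p.2 (jet f w₂ p)) -
        (prim₂ (dSnd w₁) p - prim₂ (dSnd w₂) p) := by
    simp only [cauchyStep]; ring
  rw [e]
  refine (norm_sub_le _ _).trans ?_
  linarith

theorem good_zero (h : CauchyData S R r M B κ f F) : Good S R r M fun _ => 0 := by
  refine ⟨differentiableOn_const _, fun t ht q _ => ?_⟩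
  have := h.M_nonneg ht
  rw [norm_zero]; positivity

theorem dSnd_zero : dSnd (fun _ => 0) = fun _ => 0 := by ext p; simp [dSnd]

theorem norm_cauchyStep_zero_le (h : CauchyData S R r M B κ f F) {t : ℝ} (ht : t ∈ S) {p : ℂ × ℂ}
    (hp : p ∈ cone (R t) (r t) t) :
    ‖cauchyStep f F (fun _ => 0) p‖ ≤ 5 / 4 * M t * Real.exp (8 * R t / r t * ‖p.1‖) := by
  have hb := h.mem_ball ht hp
  have hM := h.M_nonneg ht
  have hR := h.one_le_R t ht
  have hκ := h.κ_nonneg t ht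
  have hj := (norm_jet_zero_le (f := f) p).trans (h.norm_f t ht _ hb)
  have hjB := h.norm_jet_lt continuousOn_const ht (h.good_zero.bound t ht) hp
  have h1 := h.lip_F t ht _ hb (jet f (fun _ => 0) p) 0 hjB
    (by rw [norm_zero]; exact (norm_nonneg _).trans_lt hjB)
  rw [h.F_zero t ht _ hb, sub_zero, sub_zero] at h1
  have hκ1 : κ t ≤ 1 / 4 := by
    have := h.κ_le t ht
    nlinarith [mul_le_mul_of_nonneg_left (show (1 : ℝ) ≤ R t ^ 2 by nlinarith) hκ]
  have h2 : ‖F p.2 (jet f (fun _ => 0) p)‖ ≤ 1 / 4 * M t :=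
    h1.trans (mul_le_mul hκ1 hj (norm_nonneg _) (by norm_num))
  have h3 := h.norm_deriv_f t ht _ hb
  have h4 : (1 : ℝ) ≤ Real.exp (8 * R t / r t * ‖p.1‖) :=
    Real.one_le_exp (mul_nonneg (h.K_pos ht).le (norm_nonneg _))
  have h5 : ‖cauchyStep f F (fun _ => 0) p‖ ≤ 5 / 4 * M t := by
    rw [cauchyStep, dSnd_zero, prim₂_zero, sub_zero]
    refine (norm_add_le _ _).trans ?_
    rw [norm_neg]
    linarith
  exact h5.trans (le_mul_of_one_le_right (by positivity) h4)

theorem differentiableOn_comp_snd (h : CauchyData S R r M B κ f F) :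
    DifferentiableOn ℂ (fun p : ℂ × ℂ => f p.2) (coneUnion S R r) := by
  rintro p ⟨t, ht, hp⟩
  have h1 := (h.diff_f t ht).differentiableAt (isOpen_ball.mem_nhds (h.mem_ball ht hp))
  exact (h1.comp p differentiableAt_snd).differentiableWithinAt

theorem differentiableOn_deriv_comp_snd (h : CauchyData S R r M B κ f F) :
    DifferentiableOn ℂ (fun p : ℂ × ℂ => deriv f p.2) (coneUnion S R r) := by
  rintro p ⟨t, ht, hp⟩
  have h1 := ((h.diff_f t ht).deriv isOpen_ball).differentiableAt
    (isOpen_ball.mem_nhds (h.mem_ball ht hp))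
  exact (h1.comp p differentiableAt_snd).differentiableWithinAt

theorem Good.cauchyStep (h : CauchyData S R r M B κ f F) (hw : Good S R r M w) :
    Good S R r M (cauchyStep f F w) := by
  have hDo := isOpen_coneUnion S R r
  have hjet : DifferentiableOn ℂ (jet f w) (coneUnion S R r) := by
    rw [differentiableOn_pi]
    intro i
    fin_cases i
    · exact h.differentiableOn_comp_snd.add (differentiableOn_prim₂ hDo h.rayStable hw.diff)
    · exact differentiableOn_prim hDo h.rayStable hw.diff
    · exact hw.diff
  constructor
  · refine (h.differentiableOn_deriv_comp_snd.neg.sub (differentiableOn_prim₂ hDo h.rayStable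
      (differentiableOn_dSnd hDo hw.diff))).add ?_
    refine h.diff_F.comp (differentiable_snd.differentiableOn.prodMk hjet) ?_
    rintro p ⟨t, ht, hp⟩
    exact ⟨t, ht, h.mem_ball ht hp, h.norm_jet_lt hw.diff.continuousOn ht (hw.bound t ht) hp⟩
  · intro t ht p hp
    have h1 := h.norm_cauchyStep_sub_le hw h.good_zero ht (C := 3 * M t)
      (by simpa using hw.bound t ht) hp
    have h2 := h.norm_cauchyStep_zero_le ht hp
    have h3 := norm_le_norm_add_norm_sub' (_root_.cauchyStep f F w p)
      (_root_.cauchyStep f F (fun _ => 0) p)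
    have h4 : 0 ≤ M t * Real.exp (8 * R t / r t * ‖p.1‖) :=
      mul_nonneg (h.M_nonneg ht) (Real.exp_pos _).le
    nlinarith

theorem RealOn.cauchyStep (h : CauchyData S R r M B κ f F) (hw : Good S R r M w)
    (hr : RealOn (coneUnion S R r) w) : RealOn (coneUnion S R r) (cauchyStep f F w) := by
  have hDo := isOpen_coneUnion S R r
  intro x τ hp
  obtain ⟨t, ht, hpt⟩ := id hp
  have hb := h.mem_ball ht hpt
  have h1 : (deriv f τ).im = 0 := by
    refine im_eq_zero_of_hasDerivAt ((h.diff_f t ht).differentiableAt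
      (isOpen_ball.mem_nhds hb)).hasDerivAt ?_
    filter_upwards [Complex.continuous_ofReal.continuousAt.preimage_mem_nhds
      (isOpen_ball.mem_nhds hb)] with y hy
    exact h.real_f t ht y hy
  have h2 := (hr.dSnd hDo hw.diff).prim₂ h.rayStable (differentiableOn_dSnd hDo hw.diff).continuousOn
    x τ hp
  have h3 := h.real_F t ht τ hb _
    (h.norm_jet_lt hw.diff.continuousOn ht (hw.bound t ht) hpt) (fun i => by
      fin_cases i
      · simp [jet, h.real_f t ht τ hb, hr.prim₂ h.rayStable hw.diff.continuousOn x τ hp]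
      · simpa [jet] using hr.prim h.rayStable hw.diff.continuousOn x τ hp
      · simpa [jet] using hr x τ hp)
  simp [_root_.cauchyStep, h1, h2, h3]

/-- `cauchyStep` has a fixed point, in exponentially weighted sup norms over the cones. -/
theorem exists_fixedPoint (h : CauchyData S R r M B κ f F) : ∃ v, Good S R r M v ∧
    RealOn (coneUnion S R r) v ∧ ∀ p ∈ coneUnion S R r, v p = cauchyStep f F v p := by
  set W : ℕ → ℂ × ℂ → ℂ := fun m => (cauchyStep f F)^[m] fun _ => 0 with hW
  have hsucc : ∀ m, W (m + 1) = cauchyStep f F (W m) := fun m =>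
    Function.iterate_succ_apply' _ _ _
  have hgood : ∀ m, Good S R r M (W m) := fun m => by
    induction m with
    | zero => exact h.good_zero
    | succ m ih => rw [hsucc]; exact Good.cauchyStep h ih
  have hreal : ∀ m, RealOn (coneUnion S R r) (W m) := fun m => by
    induction m with
    | zero => intro x t _; simp [hW]
    | succ m ih => rw [hsucc]; exact RealOn.cauchyStep h (hgood m) ih
  have hdiff : ∀ t ∈ S, ∀ m, ∀ q ∈ cone (R t) (r t) t, ‖W m q - W (m + 1) q‖ ≤
      (3 * M t * (1 / 2) ^ m) * Real.exp (8 * R t / r t * ‖q.1‖) := by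
    intro t ht m
    induction m with
    | zero =>
      intro q hq
      have := (hgood 1).bound t ht q hq
      simpa [hW] using this
    | succ m ih =>
      intro q hq
      have := h.norm_cauchyStep_sub_le (hgood m) (hgood (m + 1)) ht ih hq
      rw [← hsucc, ← hsucc] at this
      refine this.trans (le_of_eq ?_)
      rw [pow_succ]; ring
  have hgeo : ∀ t ∈ S, ∀ q ∈ cone (R t) (r t) t, ∀ m, dist (W m q) (W (m + 1) q) ≤
      3 * M t * Real.exp (8 * R t / r t * ‖q.1‖) * (1 / 2) ^ m := by
    intro t ht q hq m
    rw [dist_eq_norm]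
    refine (hdiff t ht m q hq).trans (le_of_eq (by ring))
  set v : ℂ × ℂ → ℂ := fun p => limUnder atTop fun m => W m p with hv
  have hlim : ∀ p ∈ coneUnion S R r, Tendsto (fun m => W m p) atTop (𝓝 (v p)) := by
    rintro p ⟨t, ht, hp⟩
    exact (cauchySeq_of_le_geometric _ _ (by norm_num) (hgeo t ht p hp)).tendsto_limUnder
  have hrate : ∀ t ∈ S, ∀ m, ∀ q ∈ cone (R t) (r t) t, ‖v q - W m q‖ ≤
      (6 * M t * (1 / 2) ^ m) * Real.exp (8 * R t / r t * ‖q.1‖) := by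
    intro t ht m q hq
    have := dist_le_of_le_geometric_of_tendsto (1 / 2) _ (by norm_num) (hgeo t ht q hq)
      (hlim q ⟨t, ht, hq⟩) m
    rw [dist_comm, dist_eq_norm] at this
    refine this.trans (le_of_eq (by ring))
  have hpow : Tendsto (fun m : ℕ => (1 / 2 : ℝ) ^ m) atTop (𝓝 0) :=
    tendsto_pow_atTop_nhds_zero_of_lt_one (by norm_num) (by norm_num)
  have hvgood : Good S R r M v := by
    constructor
    · rintro p ⟨t, ht, hp⟩
      have hunif : TendstoUniformlyOn W v atTop (cone (R t) (r t) t) := by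
        rw [Metric.tendstoUniformlyOn_iff]
        intro ε hε
        have h1 : Tendsto (fun m : ℕ => 6 * M t * (1 / 2 : ℝ) ^ m *
            Real.exp (8 * R t / r t * R t)) atTop (𝓝 0) := by
          simpa using (hpow.const_mul (6 * M t)).mul_const (Real.exp (8 * R t / r t * R t))
        filter_upwards [h1.eventually (gt_mem_nhds hε)] with m hm q hq
        rw [dist_eq_norm]
        refine (hrate t ht m q hq).trans_lt (lt_of_le_of_lt ?_ hm)
        have := h.M_nonneg ht
        have := (h.K_pos ht).le
        gcongr
        exact hq.1.le
      have h2 := differentiableOn_of_tendstoUniformlyOn (isOpen_cone _ _ _)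
        (fun m => (hgood m).diff.mono fun q hq => ⟨t, ht, hq⟩) hunif
      exact (h2.differentiableAt ((isOpen_cone _ _ _).mem_nhds hp)).differentiableWithinAt
    · intro t ht p hp
      exact le_of_tendsto (hlim p ⟨t, ht, hp⟩).norm
        (Eventually.of_forall fun m => (hgood m).bound t ht p hp)
  refine ⟨v, hvgood, fun x t hp => ?_, ?_⟩
  · have h1 := (Complex.continuous_im.tendsto _).comp (hlim _ hp)
    refine tendsto_nhds_unique h1 (tendsto_const_nhds.congr fun m => ?_)
    exact (hreal m x t hp).symm
  · rintro p ⟨t, ht, hp⟩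
    have hpD : p ∈ coneUnion S R r := ⟨t, ht, hp⟩
    refine tendsto_nhds_unique ((hlim p hpD).comp (tendsto_add_atTop_nat 1)) ?_
    rw [tendsto_iff_norm_sub_tendsto_zero]
    have h1 : Tendsto (fun m : ℕ => 1 / 2 * (6 * M t * (1 / 2 : ℝ) ^ m) *
        Real.exp (8 * R t / r t * ‖p.1‖)) atTop (𝓝 0) := by
      simpa only [mul_zero, zero_mul] using ((hpow.const_mul (6 * M t)).const_mul
        (1 / 2)).mul_const (Real.exp (8 * R t / r t * ‖p.1‖))
    refine squeeze_zero (fun _ => norm_nonneg _) (fun m => ?_) h1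
    simp only [Function.comp_apply]
    rw [hsucc, norm_sub_rev]
    exact h.norm_cauchyStep_sub_le hvgood (hgood m) ht (hrate t ht m) hp

end CauchyData

end Solver

section Complexification

open Metric Topology Set

variable {ι : Type*} [Fintype ι] [DecidableEq ι]

/-- The complex extension of the homogeneous polynomial of a real multilinear form on `ι → ℝ`. -/
noncomputable def complexifyForm {m : ℕ} (φ : ContinuousMultilinearMap ℝ (fun _ : Fin m => ι → ℝ) ℝ)
    (y : ι → ℂ) : ℂ :=
  ∑ σ : Fin m → ι, (φ (fun j => Pi.single (σ j) 1) : ℂ) * ∏ j, y (σ j)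

theorem differentiable_complexifyForm {m : ℕ}
    (φ : ContinuousMultilinearMap ℝ (fun _ : Fin m => ι → ℝ) ℝ) :
    Differentiable ℂ (complexifyForm φ) := by
  unfold complexifyForm
  fun_prop

theorem complexifyForm_ofReal {m : ℕ}
    (φ : ContinuousMultilinearMap ℝ (fun _ : Fin m => ι → ℝ) ℝ) (y : ι → ℝ) :
    complexifyForm φ (fun i => (y i : ℂ)) = φ fun _ => y := by
  have h : (fun _ : Fin m => y) = fun _ : Fin m => ∑ i, y i • (Pi.single i 1 : ι → ℝ) := by
    ext _ k
    simp [Finset.sum_apply, Pi.single_apply]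
  rw [h, φ.map_sum, complexifyForm]
  push_cast
  refine Finset.sum_congr rfl fun σ _ => ?_
  rw [φ.map_smul_univ (fun j => y (σ j)) fun j => (Pi.single (σ j) 1 : ι → ℝ)]
  simp [mul_comm]

theorem norm_complexifyForm_le {m : ℕ}
    (φ : ContinuousMultilinearMap ℝ (fun _ : Fin m => ι → ℝ) ℝ) (y : ι → ℂ) :
    ‖complexifyForm φ y‖ ≤ ‖φ‖ * (Fintype.card ι * ‖y‖) ^ m := by
  have h : ∀ σ : Fin m → ι, ‖(φ (fun j => Pi.single (σ j) 1) : ℂ) * ∏ j, y (σ j)‖ ≤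
      ‖φ‖ * ‖y‖ ^ m := by
    intro σ
    rw [norm_mul, Complex.norm_real, norm_prod]
    have h1 := φ.le_opNorm fun j => (Pi.single (σ j) 1 : ι → ℝ)
    have h2 : ∏ j, ‖(Pi.single (σ j) 1 : ι → ℝ)‖ = 1 :=
      Finset.prod_eq_one fun j _ => by rw [Pi.norm_single]; simp
    rw [h2, mul_one] at h1
    have h3 : ∏ j, ‖y (σ j)‖ ≤ ∏ _j : Fin m, ‖y‖ :=
      Finset.prod_le_prod (fun _ _ => norm_nonneg _) fun j _ => norm_le_pi_norm y (σ j)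
    rw [Finset.prod_const, Finset.card_univ, Fintype.card_fin] at h3
    exact mul_le_mul h1 h3 (Finset.prod_nonneg fun _ _ => norm_nonneg _) (norm_nonneg _)
  refine (norm_sum_le_of_le _ fun σ _ => h σ).trans (le_of_eq ?_)
  rw [Finset.sum_const, Finset.card_univ, Fintype.card_fun, Fintype.card_fin, nsmul_eq_mul]
  push_cast
  ring

/-- A real-analytic function on `ι → ℝ` extends holomorphically near the origin. -/
theorem AnalyticAt.exists_holomorphic_extension {g : (ι → ℝ) → ℝ} (hg : AnalyticAt ℝ g 0) :
    ∃ (G : (ι → ℂ) → ℂ) (η : ℝ), 0 < η ∧ DifferentiableOn ℂ G (ball 0 η) ∧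
      ∀ y : ι → ℝ, ‖y‖ < η → G (fun i => (y i : ℂ)) = g y := by
  obtain ⟨p, ρ, hp⟩ := hg
  obtain ⟨a, ha0, haρ⟩ := ENNReal.lt_iff_exists_nnreal_btwn.1 hp.r_pos
  have ha : (0 : ℝ) < a := by exact_mod_cast ha0
  have hsum : Summable fun m => ‖p m‖ * (a : ℝ) ^ m :=
    p.summable_norm_mul_pow (haρ.trans_le hp.r_le)
  set η : ℝ := a / (Fintype.card ι + 1) with hη
  have hη0 : 0 < η := by positivity
  have hηa : Fintype.card ι * η ≤ a := by
    rw [hη, mul_div_assoc', div_le_iff₀ (by positivity)]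
    nlinarith
  have hηa' : η ≤ a := div_le_self ha.le (by linarith [(Nat.cast_nonneg (Fintype.card ι) : (0:ℝ) ≤ _)])
  have hbd : ∀ m, ∀ y ∈ ball (0 : ι → ℂ) η, ‖complexifyForm (p m) y‖ ≤ ‖p m‖ * (a : ℝ) ^ m := by
    intro m y hy
    rw [mem_ball_zero_iff] at hy
    refine (norm_complexifyForm_le _ _).trans ?_
    gcongr
    exact le_trans (by gcongr) hηa
  refine ⟨fun y => ∑' m, complexifyForm (p m) y, η, hη0, ?_, fun y hy => ?_⟩
  · exact differentiableOn_of_tendstoUniformlyOn isOpen_ball (fun k =>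
      (Differentiable.fun_sum fun m _ => differentiable_complexifyForm (p m)).differentiableOn)
      (tendstoUniformlyOn_tsum_nat hsum hbd)
  · have hy' : y ∈ Metric.eball (0 : ι → ℝ) ρ := by
      rw [mem_eball_zero_iff]
      refine lt_trans ?_ haρ
      rw [← ofReal_norm, ← ENNReal.ofReal_coe_nnreal]
      exact (ENNReal.ofReal_lt_ofReal_iff ha).2 (hy.trans_le hηa')
    have h1 := hp.hasSum hy'
    rw [zero_add] at h1
    have h2 := h1.mapL Complex.ofRealCLM
    simp only [Complex.ofRealCLM_apply] at h2
    simp only [complexifyForm_ofReal]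
    exact h2.tsum_eq

theorem AnalyticAt.exists_holomorphic_extension_of_fderiv_eq_zero {g : (ι → ℝ) → ℝ}
    (hg : AnalyticAt ℝ g 0) (hg0 : g 0 = 0) (hg' : fderiv ℝ g 0 = 0) :
    ∃ (G : (ι → ℂ) → ℂ) (η L : ℝ), 0 < η ∧ 0 ≤ L ∧ DifferentiableOn ℂ G (ball 0 η) ∧ G 0 = 0 ∧
      (∀ ρ ≤ η, ∀ y y', ‖y‖ < ρ → ‖y'‖ < ρ → ‖G y - G y'‖ ≤ L * ρ * ‖y - y'‖) ∧
      ∀ y : ι → ℝ, ‖y‖ < η → G (fun i => (y i : ℂ)) = g y := by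
  obtain ⟨G, η, hη, hG, hGg⟩ := hg.exists_holomorphic_extension
  have hnhds : ball (0 : ι → ℂ) η ∈ 𝓝 0 := ball_mem_nhds _ hη
  have hGd : DifferentiableAt ℂ G 0 := hG.differentiableAt hnhds
  have hcast : HasFDerivAt (fun y : ι → ℝ => fun i => (y i : ℂ))
      (ContinuousLinearMap.pi fun i =>
        Complex.ofRealCLM.comp (ContinuousLinearMap.proj (R := ℝ) (φ := fun _ : ι => ℝ) i)) 0 := by
    rw [hasFDerivAt_pi]
    intro i
    exact (Complex.ofRealCLM.comp
      (ContinuousLinearMap.proj (R := ℝ) (φ := fun _ : ι => ℝ) i)).hasFDerivAt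
  have hderiv : fderiv ℂ G 0 = 0 := by
    have h1 : HasFDerivAt G (fderiv ℂ G 0) (fun i => (((0 : ι → ℝ) i : ℝ) : ℂ)) := by
      simpa [Pi.zero_def] using hGd.hasFDerivAt
    have h2 := (h1.restrictScalars ℝ).comp 0 hcast
    have h3 : HasFDerivAt (fun y : ι → ℝ => (g y : ℂ)) (0 : (ι → ℝ) →L[ℝ] ℂ) 0 := by
      have := Complex.ofRealCLM.hasFDerivAt.comp (0 : ι → ℝ) hg.differentiableAt.hasFDerivAt
      rw [hg', ContinuousLinearMap.comp_zero] at this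
      exact this
    have h4 := h2.unique (h3.congr_of_eventuallyEq (by
      filter_upwards [ball_mem_nhds (0 : ι → ℝ) hη] with y hy
      exact hGg y (mem_ball_zero_iff.1 hy)))
    have h5 : ∀ i, fderiv ℂ G 0 (Pi.single i 1) = 0 := by
      intro i
      have := DFunLike.congr_fun h4 (Pi.single i 1)
      simp only [ContinuousLinearMap.comp_apply, ContinuousLinearMap.coe_restrictScalars',
        _root_.zero_apply] at this
      rw [← this]
      congr 1
      ext j
      by_cases hij : j = i
      · subst hij; simp
      · simp [hij]
    ext v
    have hv : v = ∑ i, v i • (Pi.single i 1 : ι → ℂ) := by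
      ext k
      simp [Finset.sum_apply, Pi.single_apply]
    rw [hv, map_sum]
    simp [h5]
  have hC : ContDiffAt ℝ 1 (fderiv ℂ G) 0 := by
    have h1 := (contDiffOn_of_differentiableOn_finiteDimensional isOpen_ball hG).contDiffAt hnhds
    have h2 : ContDiffAt ℂ 1 (fderiv ℂ G) 0 := h1.fderiv_right (m := 1) (by norm_cast)
    exact h2.restrict_scalars ℝ
  obtain ⟨L, T, hT, hL⟩ := hC.exists_lipschitzOnWith
  obtain ⟨η', hη', hsub⟩ := Metric.mem_nhds_iff.1 (inter_mem hT hnhds)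
  refine ⟨G, min η η', L, lt_min hη hη', L.2, hG.mono (ball_subset_ball (min_le_left _ _)), ?_, ?_,
    fun y hy => hGg y (hy.trans_le (min_le_left _ _))⟩
  · have := hGg 0 (by simpa using hη)
    rw [hg0] at this
    simpa [Pi.zero_def] using this
  · intro ρ hρ y y' hy hy'
    have hm : ∀ z ∈ ball (0 : ι → ℂ) ρ, z ∈ T ∩ ball (0 : ι → ℂ) η := fun z hz =>
      hsub (ball_subset_ball (hρ.trans (min_le_right _ _)) hz)
    refine (convex_ball (0 : ι → ℂ) ρ).norm_image_sub_le_of_norm_fderiv_le (𝕜 := ℂ) (fun z hz =>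
      hG.differentiableAt (isOpen_ball.mem_nhds (hm z hz).2)) (fun z hz => ?_)
      (mem_ball_zero_iff.2 hy') (mem_ball_zero_iff.2 hy)
    have h1 := hL.dist_le_mul z (hm z hz).1 0 (mem_of_mem_nhds hT)
    rw [hderiv, dist_zero_right, dist_zero_right] at h1
    refine h1.trans ?_
    have : ‖z‖ ≤ ρ := (mem_ball_zero_iff.1 hz).le
    gcongr

end Complexification

section IteratedExponential

open Metric Topology Set

theorem iterExp_le_succ (j : ℕ) (x : ℝ) : iterExp j x ≤ iterExp (j + 1) x :=
  (le_add_of_nonneg_right zero_le_one).trans (Real.add_one_le_exp _)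

theorem iterExp_mono_left {j k : ℕ} (h : j ≤ k) (x : ℝ) : iterExp j x ≤ iterExp k x :=
  monotone_nat_of_le_succ (fun j => iterExp_le_succ j x) h

theorem monotone_iterExp (j : ℕ) : Monotone (iterExp j) := by
  induction j with
  | zero => exact monotone_id
  | succ j ih => exact Real.exp_monotone.comp ih

theorem le_iterExp (j : ℕ) (x : ℝ) : x ≤ iterExp j x := iterExp_mono_left (Nat.zero_le j) x

theorem iterExp_exp (j : ℕ) (x : ℝ) : iterExp j (Real.exp x) = iterExp (j + 1) x := by
  induction j with
  | zero => rfl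
  | succ j ih => exact congrArg Real.exp ih

theorem sq_le_exp {x : ℝ} (hx : 0 ≤ x) : x ^ 2 ≤ Real.exp x := by
  have h1 := Real.add_one_le_exp (x / 2 - 1)
  have h2 : (2 : ℝ) ≤ Real.exp 1 := by have := Real.add_one_le_exp (1 : ℝ); linarith
  have h3 : Real.exp (x / 2) = Real.exp 1 * Real.exp (x / 2 - 1) := by
    rw [← Real.exp_add]; congr 1; ring
  have h4 : x ≤ Real.exp (x / 2) := by
    rw [h3]
    nlinarith [Real.exp_pos (x / 2 - 1)]
  calc x ^ 2 ≤ Real.exp (x / 2) ^ 2 := by gcongr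
    _ = Real.exp x := by rw [← Real.exp_nat_mul]; congr 1; push_cast; ring

theorem iterExp_sq_le (N : ℕ) {x : ℝ} (hx : 0 ≤ x) : iterExp N (x ^ 2) ≤ iterExp (N + 1) x := by
  rw [← iterExp_exp]
  exact monotone_iterExp N (sq_le_exp hx)

/-- The complex iterated exponential. -/
noncomputable def cIterExp : ℕ → ℂ → ℂ
  | 0 => fun z => z
  | (N + 1) => fun z => Complex.exp (cIterExp N z)

theorem differentiable_cIterExp (j : ℕ) : Differentiable ℂ (cIterExp j) := by
  induction j with
  | zero => exact differentiable_id
  | succ j ih => exact ih.cexp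

theorem cIterExp_ofReal (j : ℕ) (x : ℝ) : cIterExp j x = iterExp j x := by
  induction j with
  | zero => rfl
  | succ j ih => simp [cIterExp, iterExp, ih]

theorem norm_exp_sub_exp_le {a c : ℂ} (h : ‖a - c‖ ≤ 1) :
    ‖Complex.exp a - Complex.exp c‖ ≤ 2 * ‖Complex.exp c‖ * ‖a - c‖ := by
  have e : Complex.exp a - Complex.exp c = Complex.exp c * (Complex.exp (a - c) - 1) := by
    rw [mul_sub, ← Complex.exp_add]; simp
  rw [e, norm_mul]
  have := Complex.norm_exp_sub_one_le h
  nlinarith [norm_nonneg (Complex.exp c)]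

theorem norm_cIterExp_sub_le {m : ℕ} {x δ : ℝ} {ζ : ℂ} (hx : 1 ≤ x) (hζ : ‖ζ - x‖ ≤ δ)
    (hδ : (2 * iterExp m x) ^ m * δ ≤ 1) {j : ℕ} (hj : j ≤ m) :
    ‖cIterExp j ζ - iterExp j x‖ ≤ (2 * iterExp m x) ^ j * δ := by
  have hδ0 : 0 ≤ δ := (norm_nonneg _).trans hζ
  have hb : 1 ≤ iterExp m x := hx.trans (le_iterExp m x)
  induction j with
  | zero => simpa [cIterExp, iterExp] using hζ
  | succ j ih =>
    have ih := ih (by omega)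
    have h1 : ‖cIterExp j ζ - iterExp j x‖ ≤ 1 := by
      refine ih.trans (le_trans ?_ hδ)
      have : (2 * iterExp m x) ^ j ≤ (2 * iterExp m x) ^ m :=
        pow_le_pow_right₀ (by linarith) (by omega)
      gcongr
    have h2 := norm_exp_sub_exp_le h1
    have h3 : ‖Complex.exp (iterExp j x)‖ = iterExp (j + 1) x := by
      rw [Complex.norm_exp, Complex.ofReal_re]; rfl
    have h4 : iterExp (j + 1) x ≤ iterExp m x := iterExp_mono_left hj x
    have h5 : cIterExp (j + 1) ζ - iterExp (j + 1) x =
        Complex.exp (cIterExp j ζ) - Complex.exp (iterExp j x) := by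
      simp [cIterExp, iterExp]
    rw [h5]
    refine h2.trans ?_
    rw [h3, pow_succ]
    calc 2 * iterExp (j + 1) x * ‖cIterExp j ζ - iterExp j x‖
        ≤ 2 * iterExp m x * ((2 * iterExp m x) ^ j * δ) := by gcongr
      _ = _ := by ring

theorem norm_exp_neg_cIterExp_le {m : ℕ} {x δ : ℝ} {ζ : ℂ} (hx : 1 ≤ x) (hζ : ‖ζ - x‖ ≤ δ)
    (hδ : (2 * iterExp m x) ^ m * δ ≤ 1 / 4) :
    ‖Complex.exp (-cIterExp (m + 1) ζ)‖ ≤ Real.exp (-(1 / 2 * Real.exp (iterExp m x))) := by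
  rw [Complex.norm_exp, Real.exp_le_exp, Complex.neg_re, neg_le_neg_iff]
  have h1 := norm_cIterExp_sub_le hx hζ (by linarith) le_rfl
  have h2 := norm_exp_sub_exp_le (h1.trans (by linarith))
  have h3 : ‖Complex.exp (iterExp m x)‖ = Real.exp (iterExp m x) := by
    rw [Complex.norm_exp, Complex.ofReal_re]
  rw [h3] at h2
  have h4 : Complex.exp (iterExp m x) = (Real.exp (iterExp m x) : ℂ) := by simp
  rw [h4] at h2
  have h5 := (Complex.abs_re_le_norm _).trans h2
  rw [Complex.sub_re, Complex.ofReal_re] at h5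
  have h6 := (abs_le.1 h5).1
  have h7 := Real.exp_pos (iterExp m x)
  have h8 : (cIterExp (m + 1) ζ).re = (Complex.exp (cIterExp m ζ)).re := rfl
  rw [h8]
  nlinarith [h1.trans hδ]

/-- The radius in `x` of the cone with vertex `t`. -/
noncomputable def coneRadius (N : ℕ) (t : ℝ) : ℝ := 2 * iterExp (N + 1) (1 / t)

/-- The radius in `z` of the cone with vertex `t`. -/
noncomputable def timeRadius (N : ℕ) (t : ℝ) : ℝ := 1 / (4 * coneRadius N t ^ (N + 3))

variable {N : ℕ} {t : ℝ}

theorem one_le_one_div_of_mem_Ioo (ht : t ∈ Ioo (0 : ℝ) 1) : 1 ≤ 1 / t := by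
  rw [le_div_iff₀ ht.1]; linarith [ht.2]

theorem two_div_le_coneRadius (N : ℕ) (t : ℝ) : 2 / t ≤ coneRadius N t := by
  have := le_iterExp (N + 1) (1 / t)
  rw [coneRadius, show 2 / t = 2 * (1 / t) by ring]
  linarith

theorem two_le_coneRadius (N : ℕ) (ht : t ∈ Ioo (0 : ℝ) 1) : 2 ≤ coneRadius N t := by
  have := le_iterExp (N + 1) (1 / t)
  have := one_le_one_div_of_mem_Ioo ht
  rw [coneRadius]
  linarith

theorem iterExp_lt_coneRadius (N : ℕ) (ht : t ∈ Ioo (0 : ℝ) 1) :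
    iterExp N (1 / t ^ 2) < coneRadius N t := by
  have h1 := one_le_one_div_of_mem_Ioo ht
  have h2 := iterExp_sq_le N (x := 1 / t) (by linarith)
  have h3 := le_iterExp (N + 1) (1 / t)
  rw [div_pow, one_pow] at h2
  rw [coneRadius]
  linarith

theorem timeRadius_pos (N : ℕ) (ht : t ∈ Ioo (0 : ℝ) 1) : 0 < timeRadius N t := by
  have := two_le_coneRadius N ht
  rw [timeRadius]
  positivity

theorem two_mul_timeRadius_le (N : ℕ) (ht : t ∈ Ioo (0 : ℝ) 1) : 2 * timeRadius N t ≤ t / 2 := by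
  have h1 := two_le_coneRadius N ht
  have h2 := two_div_le_coneRadius N t
  have h3 : coneRadius N t ≤ coneRadius N t ^ (N + 3) := le_self_pow₀ (by linarith) (by omega)
  have h4 := ht.1
  have h5 : 0 < coneRadius N t ^ (N + 3) := by positivity
  rw [div_le_iff₀ h4] at h2
  rw [timeRadius, mul_one_div, div_le_div_iff₀ (by positivity) (by norm_num)]
  nlinarith

theorem half_le_norm_and_norm_le_two (N : ℕ) (ht : t ∈ Ioo (0 : ℝ) 1) {z : ℂ}
    (hz : ‖z - t‖ ≤ 2 * timeRadius N t) : t / 2 ≤ ‖z‖ ∧ ‖z‖ ≤ 2 := by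
  have h1 := two_mul_timeRadius_le N ht
  have h2 : ‖(t : ℂ)‖ = t := by
    rw [Complex.norm_real, Real.norm_eq_abs, abs_of_pos ht.1]
  have h3 := norm_sub_norm_le (t : ℂ) z
  have h4 := norm_le_norm_add_norm_sub' z (t : ℂ)
  rw [norm_sub_rev] at h3
  constructor <;> linarith [ht.1, ht.2]

theorem norm_exp_neg_cIterExp_one_div_le (N : ℕ) (ht : t ∈ Ioo (0 : ℝ) 1) {z : ℂ}
    (hz : ‖z - t‖ ≤ 2 * timeRadius N t) :
    ‖Complex.exp (-cIterExp (N + 2) (1 / z))‖ ≤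
      Real.exp (-(1 / 2 * Real.exp (coneRadius N t / 2))) := by
  have h0 := ht.1
  have hn := (half_le_norm_and_norm_le_two N ht hz).1
  have hz0 : z ≠ 0 := norm_pos_iff.1 (by linarith)
  have ht0 : (t : ℂ) ≠ 0 := by exact_mod_cast h0.ne'
  have hR := two_le_coneRadius N ht
  have hR' := two_div_le_coneRadius N t
  have hr := timeRadius_pos N ht
  have hδ : ‖1 / z - ((1 / t : ℝ) : ℂ)‖ ≤ timeRadius N t * coneRadius N t ^ 2 := by
    have e : 1 / z - ((1 / t : ℝ) : ℂ) = -(z - t) / (z * t) := by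
      push_cast; field_simp; ring
    rw [e, norm_div, norm_neg, norm_mul, Complex.norm_real, Real.norm_eq_abs, abs_of_pos h0,
      div_le_iff₀ (by positivity)]
    refine hz.trans ?_
    rw [div_le_iff₀ h0] at hR'
    calc 2 * timeRadius N t = timeRadius N t * (2 * (2 / 2)) := by ring
      _ ≤ timeRadius N t * ((coneRadius N t * t) * (coneRadius N t * t / 2)) := by
          gcongr
      _ = timeRadius N t * coneRadius N t ^ 2 * (t / 2 * t) := by ring
      _ ≤ _ := by gcongr
  have h1 := norm_exp_neg_cIterExp_le (m := N + 1) (one_le_one_div_of_mem_Ioo ht) hδ (by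
    change coneRadius N t ^ (N + 1) * (timeRadius N t * coneRadius N t ^ 2) ≤ _
    rw [timeRadius]
    have : 0 < coneRadius N t := by linarith
    refine le_of_eq ?_
    field_simp
    ring)
  rwa [show coneRadius N t / 2 = iterExp (N + 1) (1 / t) by rw [coneRadius]; ring]

theorem exists_pow_mul_exp_le (c m : ℕ) (hm : 1 ≤ m) : ∃ C : ℝ, 0 < C ∧ ∀ R : ℝ, 1 ≤ R →
    R ^ c * Real.exp (32 * R ^ m) * Real.exp (-(1 / 2 * Real.exp (R / 2))) ≤ C := by
  set α : ℝ := 1 / (2 * 2 ^ (m + 1) * (m + 1).factorial) with hα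
  have hα0 : 0 < α := by positivity
  refine ⟨Real.exp ((c + 32) * ((c + 32) / α) ^ m), Real.exp_pos _, fun R hR => ?_⟩
  have h1 : R ^ c ≤ Real.exp (c * R) := by
    rw [Real.exp_nat_mul]
    have := Real.add_one_le_exp R
    gcongr
    linarith
  have h2 : α * R ^ (m + 1) ≤ 1 / 2 * Real.exp (R / 2) := by
    have := Real.pow_div_factorial_le_exp (R / 2) (by linarith) (m + 1)
    calc α * R ^ (m + 1) = 1 / 2 * ((R / 2) ^ (m + 1) / (m + 1).factorial) := by
          rw [hα, div_pow]; field_simp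
      _ ≤ _ := by gcongr
  calc R ^ c * Real.exp (32 * R ^ m) * Real.exp (-(1 / 2 * Real.exp (R / 2)))
      ≤ Real.exp (c * R) * Real.exp (32 * R ^ m) * Real.exp (-(1 / 2 * Real.exp (R / 2))) := by
        gcongr
    _ = Real.exp (c * R + 32 * R ^ m - 1 / 2 * Real.exp (R / 2)) := by
        rw [← Real.exp_add, ← Real.exp_add]; ring_nf
    _ ≤ _ := by
        rw [Real.exp_le_exp]
        have h3 : R ≤ R ^ m := le_self_pow₀ hR (by omega)
        have h4 : (c : ℝ) * R + 32 * R ^ m ≤ (c + 32) * R ^ m := by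
          have : (c : ℝ) * R ≤ c * R ^ m := by gcongr
          linarith
        rcases le_total R ((c + 32) / α) with h | h
        · have h5 : ((c : ℝ) + 32) * R ^ m ≤ (c + 32) * ((c + 32) / α) ^ m := by gcongr
          have := Real.exp_pos (R / 2)
          linarith
        · rw [div_le_iff₀ hα0] at h
          have h5 : ((c : ℝ) + 32) * R ^ m ≤ R * α * R ^ m := by gcongr
          have h6 : R * α * R ^ m = α * R ^ (m + 1) := by ring
          have h7 : (0 : ℝ) ≤ (c + 32) * ((c + 32) / α) ^ m := by positivity
          linarith

theorem norm_cpow_ofReal_le {z : ℂ} {α R : ℝ} {a : ℕ} (hα : |α| ≤ a) (hR : 2 ≤ R) (hz0 : z ≠ 0)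
    (hz : 1 ≤ R * ‖z‖) (hz2 : ‖z‖ ≤ 2) : ‖z ^ (α : ℂ)‖ ≤ R ^ a := by
  rw [Complex.norm_cpow_of_ne_zero hz0, Complex.ofReal_re, Complex.ofReal_im, mul_zero,
    Real.exp_zero, div_one, ← Real.rpow_natCast]
  have hn : 0 < ‖z‖ := norm_pos_iff.2 hz0
  have hRa : R ^ |α| ≤ R ^ (a : ℝ) := Real.rpow_le_rpow_of_exponent_le (by linarith) hα
  refine le_trans ?_ hRa
  rcases le_total 0 α with h | h
  · rw [abs_of_nonneg h]
    exact Real.rpow_le_rpow hn.le (by linarith) h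
  · rw [abs_of_nonpos h]
    have h1 : ‖z‖ ^ α = (‖z‖⁻¹) ^ (-α) := by
      rw [Real.inv_rpow hn.le, Real.rpow_neg hn.le, inv_inv]
    rw [h1]
    refine Real.rpow_le_rpow (by positivity) ?_ (by linarith)
    rw [inv_le_iff_one_le_mul₀ hn]
    exact hz

end IteratedExponential

section ConcreteData

open Metric Topology Set

/-- The flat Cauchy datum `ε exp (-E_{N+2}(1/z))`. -/
noncomputable def flatDatum (ε : ℝ) (N : ℕ) (z : ℂ) : ℂ :=
  ε * Complex.exp (-cIterExp (N + 2) (1 / z))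

/-- A bound for `flatDatum` and its derivative near `t`. -/
noncomputable def datumBound (ε : ℝ) (N : ℕ) (t : ℝ) : ℝ :=
  ε * Real.exp (-(1 / 2 * Real.exp (coneRadius N t / 2))) / timeRadius N t

/-- A bound for the jet of the solution over the cone with vertex `t`. -/
noncomputable def jetBound (ε : ℝ) (N : ℕ) (t : ℝ) : ℝ :=
  5 * coneRadius N t ^ 2 * datumBound ε N t *
    Real.exp (8 * coneRadius N t / timeRadius N t * coneRadius N t)

/-- The jet with components multiplied by powers of `z`. -/
noncomputable def weightJet (α : Fin 3 → ℝ) (z : ℂ) (Y : Fin 3 → ℂ) : Fin 3 → ℂ :=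
  fun i => z ^ (α i : ℂ) * Y i

/-- The nonlinearity `s z ^ β G(z ^ α₀ Y₀, z ^ α₁ Y₁, z ^ α₂ Y₂)`. -/
noncomputable def weightedNonlinearity (s β : ℝ) (α : Fin 3 → ℝ) (G : (Fin 3 → ℂ) → ℂ) (z : ℂ)
    (Y : Fin 3 → ℂ) : ℂ :=
  s * z ^ (β : ℂ) * G (weightJet α z Y)

variable {ε : ℝ} {N : ℕ} {t : ℝ}

theorem datumBound_pos (hε : 0 < ε) (N : ℕ) (ht : t ∈ Ioo (0 : ℝ) 1) : 0 < datumBound ε N t := by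
  have := timeRadius_pos N ht
  rw [datumBound]
  positivity

theorem jetBound_pos (hε : 0 < ε) (N : ℕ) (ht : t ∈ Ioo (0 : ℝ) 1) : 0 < jetBound ε N t := by
  have := datumBound_pos hε N ht
  have := two_le_coneRadius N ht
  rw [jetBound]
  positivity

theorem exists_jetBound_le (N c : ℕ) {c₁ : ℝ} (hc₁ : 0 < c₁) :
    ∃ ε : ℝ, 0 < ε ∧ ∀ t ∈ Ioo (0 : ℝ) 1, coneRadius N t ^ c * jetBound ε N t ≤ c₁ := by
  obtain ⟨C, hC, hCb⟩ := exists_pow_mul_exp_le (c + N + 5) (N + 5) (by omega)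
  refine ⟨c₁ / (20 * C), by positivity, fun t ht => ?_⟩
  have hR := two_le_coneRadius N ht
  have h1 := hCb (coneRadius N t) (by linarith)
  have hR0 : 0 < coneRadius N t := by linarith
  have e1 : 8 * coneRadius N t / timeRadius N t * coneRadius N t =
      32 * coneRadius N t ^ (N + 5) := by
    rw [timeRadius]; field_simp; ring
  rw [jetBound, e1, datumBound, timeRadius]
  calc _ = c₁ / C * (coneRadius N t ^ (c + N + 5) * Real.exp (32 * coneRadius N t ^ (N + 5)) *
        Real.exp (-(1 / 2 * Real.exp (coneRadius N t / 2)))) := by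
        field_simp; ring
    _ ≤ c₁ / C * C := by gcongr
    _ = c₁ := by field_simp

theorem norm_flatDatum_le (hε : 0 < ε) (N : ℕ) (ht : t ∈ Ioo (0 : ℝ) 1) {z : ℂ}
    (hz : ‖z - t‖ ≤ 2 * timeRadius N t) :
    ‖flatDatum ε N z‖ ≤ ε * Real.exp (-(1 / 2 * Real.exp (coneRadius N t / 2))) := by
  rw [flatDatum, norm_mul, Complex.norm_real, Real.norm_eq_abs, abs_of_pos hε]
  gcongr
  exact norm_exp_neg_cIterExp_one_div_le N ht hz

theorem differentiableAt_flatDatum (ε : ℝ) (N : ℕ) {z : ℂ} (hz : z ≠ 0) :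
    DifferentiableAt ℂ (flatDatum ε N) z := by
  have h1 : DifferentiableAt ℂ (fun z : ℂ => 1 / z) z := by fun_prop (disch := assumption)
  have h2 : DifferentiableAt ℂ (fun z : ℂ => cIterExp (N + 2) (1 / z)) z :=
    (differentiable_cIterExp (N + 2)).differentiableAt.comp z h1
  exact h2.neg.cexp.const_mul _

theorem flatDatum_ofReal (ε : ℝ) (N : ℕ) (x : ℝ) :
    flatDatum ε N x = ((ε * Real.exp (-iterExp (N + 2) (1 / x)) : ℝ) : ℂ) := by
  rw [flatDatum, show (1 / (x : ℂ)) = ((1 / x : ℝ) : ℂ) by push_cast; rfl, cIterExp_ofReal]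
  push_cast
  rfl

theorem ne_zero_of_near (N : ℕ) (ht : t ∈ Ioo (0 : ℝ) 1) {z : ℂ}
    (hz : ‖z - t‖ ≤ 2 * timeRadius N t) : z ≠ 0 :=
  norm_pos_iff.1 (by have := (half_le_norm_and_norm_le_two N ht hz).1; linarith [ht.1])

theorem re_pos_of_near (N : ℕ) (ht : t ∈ Ioo (0 : ℝ) 1) {z : ℂ}
    (hz : ‖z - t‖ ≤ 2 * timeRadius N t) : 0 < z.re := by
  have h1 := (Complex.abs_re_le_norm (z - t)).trans (hz.trans (two_mul_timeRadius_le N ht))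
  rw [Complex.sub_re, Complex.ofReal_re] at h1
  linarith [(abs_le.1 h1).1, ht.1]

theorem norm_cpow_le_of_near (N : ℕ) (ht : t ∈ Ioo (0 : ℝ) 1) {z : ℂ}
    (hz : ‖z - t‖ ≤ 2 * timeRadius N t) {α : ℝ} {a : ℕ} (hα : |α| ≤ a) :
    ‖z ^ (α : ℂ)‖ ≤ coneRadius N t ^ a := by
  obtain ⟨h1, h2⟩ := half_le_norm_and_norm_le_two N ht hz
  refine norm_cpow_ofReal_le hα (two_le_coneRadius N ht) (ne_zero_of_near N ht hz) ?_ h2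
  have h3 := two_div_le_coneRadius N t
  rw [div_le_iff₀ ht.1] at h3
  nlinarith [two_le_coneRadius N ht]

theorem norm_weightJet_sub_le (N : ℕ) (ht : t ∈ Ioo (0 : ℝ) 1) {z : ℂ}
    (hz : ‖z - t‖ ≤ 2 * timeRadius N t) {α : Fin 3 → ℝ} {a : ℕ} (hα : ∀ i, |α i| ≤ a)
    (Y Y' : Fin 3 → ℂ) :
    ‖weightJet α z Y - weightJet α z Y'‖ ≤ coneRadius N t ^ a * ‖Y - Y'‖ := by
  have := two_le_coneRadius N ht
  rw [pi_norm_le_iff_of_nonneg (by positivity)]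
  intro i
  rw [Pi.sub_apply, weightJet, weightJet, ← mul_sub, norm_mul]
  exact mul_le_mul (norm_cpow_le_of_near N ht hz (hα i)) (norm_le_pi_norm (Y - Y') i)
    (norm_nonneg _) (by positivity)

theorem weightJet_zero (α : Fin 3 → ℝ) (z : ℂ) : weightJet α z 0 = 0 := by
  ext i; simp [weightJet]

theorem norm_weightJet_le (N : ℕ) (ht : t ∈ Ioo (0 : ℝ) 1) {z : ℂ}
    (hz : ‖z - t‖ ≤ 2 * timeRadius N t) {α : Fin 3 → ℝ} {a : ℕ} (hα : ∀ i, |α i| ≤ a)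
    (Y : Fin 3 → ℂ) : ‖weightJet α z Y‖ ≤ coneRadius N t ^ a * ‖Y‖ := by
  simpa [weightJet_zero] using norm_weightJet_sub_le N ht hz hα Y 0

theorem weightJet_ofReal (α : Fin 3 → ℝ) {x : ℝ} (hx : 0 ≤ x) (y : Fin 3 → ℝ) :
    weightJet α x (fun i => (y i : ℂ)) = fun i => ((x ^ α i * y i : ℝ) : ℂ) := by
  ext i
  rw [weightJet, ← Complex.ofReal_cpow hx]
  push_cast
  rfl

theorem norm_weightJet_lt (hε : 0 < ε) (ht : t ∈ Ioo (0 : ℝ) 1) {z : ℂ}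
    (hz : ‖z - t‖ ≤ 2 * timeRadius N t) {α : Fin 3 → ℝ} {a : ℕ} (hα : ∀ i, |α i| ≤ a) {η : ℝ}
    (hη : coneRadius N t ^ (3 * a + 2) * jetBound ε N t ≤ η) {Y : Fin 3 → ℂ}
    (hY : ‖Y‖ < jetBound ε N t) :
    ‖weightJet α z Y‖ < coneRadius N t ^ a * jetBound ε N t ∧
      coneRadius N t ^ a * jetBound ε N t ≤ η := by
  have := two_le_coneRadius N ht
  have := (jetBound_pos hε N ht).le
  constructor
  · refine (norm_weightJet_le N ht hz hα Y).trans_lt ?_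
    gcongr
  · refine le_trans ?_ hη
    gcongr
    · linarith
    · omega

theorem weightedNonlinearity_ofReal {G : (Fin 3 → ℂ) → ℂ} {g : (Fin 3 → ℝ) → ℝ} {η : ℝ}
    (hGg : ∀ y : Fin 3 → ℝ, ‖y‖ < η → G (fun i => (y i : ℂ)) = g y) (s β : ℝ) {α : Fin 3 → ℝ}
    {x : ℝ} (hx : 0 < x) {y : Fin 3 → ℝ} (hy : ‖weightJet α x (fun i => (y i : ℂ))‖ < η) :
    weightedNonlinearity s β α G x (fun i => (y i : ℂ)) =
      ((s * x ^ β * g (fun i => x ^ α i * y i) : ℝ) : ℂ) := by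
  rw [weightJet_ofReal α hx.le] at hy
  rw [weightedNonlinearity, weightJet_ofReal α hx.le, hGg _ (by
    refine lt_of_le_of_lt (le_of_eq ?_) hy
    simp only [Pi.norm_def, Complex.nnnorm_real]), ← Complex.ofReal_cpow hx.le]
  push_cast
  rfl

theorem cauchyData_weightedNonlinearity {G : (Fin 3 → ℂ) → ℂ} {g : (Fin 3 → ℝ) → ℝ} {η L : ℝ}
    (hL : 0 ≤ L) (hG : DifferentiableOn ℂ G (ball 0 η)) (hG0 : G 0 = 0)
    (hGL : ∀ ρ ≤ η, ∀ y y', ‖y‖ < ρ → ‖y'‖ < ρ → ‖G y - G y'‖ ≤ L * ρ * ‖y - y'‖)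
    (hGg : ∀ y : Fin 3 → ℝ, ‖y‖ < η → G (fun i => (y i : ℂ)) = g y)
    {α : Fin 3 → ℝ} {β s : ℝ} {a : ℕ} (hα : ∀ i, |α i| ≤ a) (hβ : |β| ≤ a) (hε : 0 < ε)
    (hs : |s| ≤ 1)
    (h₁ : ∀ t ∈ Ioo (0 : ℝ) 1, coneRadius N t ^ (3 * a + 2) * jetBound ε N t ≤ η)
    (h₂ : ∀ t ∈ Ioo (0 : ℝ) 1, L * (coneRadius N t ^ (3 * a + 2) * jetBound ε N t) ≤ 1 / 4) :
    CauchyData (Ioo 0 1) (coneRadius N) (timeRadius N) (datumBound ε N) (jetBound ε N)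
      (fun t => L * (coneRadius N t ^ (3 * a) * jetBound ε N t)) (flatDatum ε N)
      (weightedNonlinearity s β α G) := by
  have near : ∀ t ∈ Ioo (0 : ℝ) 1, ∀ z ∈ ball (t : ℂ) (timeRadius N t),
      ‖z - t‖ ≤ 2 * timeRadius N t := fun t ht z hz => by
    rw [mem_ball_iff_norm] at hz
    linarith [timeRadius_pos N ht]
  have hwj : ∀ t ∈ Ioo (0 : ℝ) 1, ∀ z ∈ ball (t : ℂ) (timeRadius N t), ∀ Y,
      ‖Y‖ < jetBound ε N t → ‖weightJet α z Y‖ < coneRadius N t ^ a * jetBound ε N t ∧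
        coneRadius N t ^ a * jetBound ε N t ≤ η := fun t ht z hz Y hY =>
    norm_weightJet_lt hε ht (near t ht z hz) hα (h₁ t ht) hY
  refine
    { one_le_R := fun t ht => by linarith [two_le_coneRadius N ht]
      r_pos := fun t ht => timeRadius_pos N ht
      diff_f := fun t ht z hz => (differentiableAt_flatDatum ε N
        (ne_zero_of_near N ht (near t ht z hz))).differentiableWithinAt
      norm_f := fun t ht z hz => ?_
      norm_deriv_f := fun t ht z hz => ?_
      diff_F := ?_
      lip_F := fun t ht z hz Y Y' hY hY' => ?_
      F_zero := fun t ht z hz => by rw [weightedNonlinearity, weightJet_zero, hG0, mul_zero]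
      κ_nonneg := fun t ht => ?_
      κ_le := fun t ht => ?_
      lt_B := fun t ht => ?_
      real_f := fun t ht x hx => by rw [flatDatum_ofReal, Complex.ofReal_im]
      real_F := fun t ht x hx Y hY hYr => ?_ }
  · refine (norm_flatDatum_le hε N ht (near t ht z hz)).trans ?_
    rw [datumBound, le_div_iff₀ (timeRadius_pos N ht)]
    refine mul_le_of_le_one_right (by positivity) ?_
    linarith [two_mul_timeRadius_le N ht, ht.2, ht.1]
  · rw [mem_ball_iff_norm] at hz
    have hr := timeRadius_pos N ht
    have near' : ∀ ζ ∈ closedBall z (timeRadius N t), ‖ζ - t‖ ≤ 2 * timeRadius N t := by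
      intro ζ hζ
      rw [mem_closedBall_iff_norm] at hζ
      have := norm_sub_le_norm_sub_add_norm_sub ζ z (t : ℂ)
      linarith
    have hd : DifferentiableOn ℂ (flatDatum ε N) (closedBall z (timeRadius N t)) := fun ζ hζ =>
      (differentiableAt_flatDatum ε N (ne_zero_of_near N ht (near' ζ hζ))).differentiableWithinAt
    exact Complex.norm_deriv_le_of_forall_mem_sphere_norm_le hr
      (hd.diffContOnCl_ball subset_rfl) fun ζ hζ =>
        norm_flatDatum_le hε N ht (near' ζ (sphere_subset_closedBall hζ))
  · rintro ⟨z, Y⟩ ⟨t, ht, hz, hY⟩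
    have hre := re_pos_of_near N ht (near t ht z hz)
    have hsl : z ∈ Complex.slitPlane := Or.inl hre
    have hz1 : ∀ c : ℂ, DifferentiableAt ℂ (fun p : ℂ × (Fin 3 → ℂ) => p.1 ^ c) (z, Y) :=
      fun c => differentiableAt_fst.cpow_const hsl
    have hw : DifferentiableAt ℂ (fun p : ℂ × (Fin 3 → ℂ) => weightJet α p.1 p.2) (z, Y) := by
      rw [differentiableAt_pi]
      intro i
      exact (hz1 _).mul (by fun_prop)
    have hGz : DifferentiableAt ℂ G (weightJet α z Y) :=
      hG.differentiableAt (isOpen_ball.mem_nhds (mem_ball_zero_iff.2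
        ((hwj t ht z hz Y hY).1.trans_le (hwj t ht z hz Y hY).2)))
    have hcomp : DifferentiableAt ℂ (fun p : ℂ × (Fin 3 → ℂ) => G (weightJet α p.1 p.2)) (z, Y) :=
      DifferentiableAt.comp (z, Y) (g := G)
        (f := fun p : ℂ × (Fin 3 → ℂ) => weightJet α p.1 p.2) hGz hw
    exact (((hz1 _).const_mul (s : ℂ)).mul hcomp).differentiableWithinAt
  · have hR := two_le_coneRadius N ht
    have hB := jetBound_pos hε N ht
    have hG1 := hGL _ (hwj t ht z hz Y hY).2 _ _ (hwj t ht z hz Y hY).1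
      (hwj t ht z hz Y' hY').1
    have hw := norm_weightJet_sub_le N ht (near t ht z hz) hα Y Y'
    have hzβ := norm_cpow_le_of_near N ht (near t ht z hz) hβ
    rw [weightedNonlinearity, weightedNonlinearity, ← mul_sub, norm_mul, norm_mul,
      Complex.norm_real, Real.norm_eq_abs]
    calc |s| * ‖z ^ (β : ℂ)‖ * ‖G (weightJet α z Y) - G (weightJet α z Y')‖
        ≤ 1 * coneRadius N t ^ a * (L * (coneRadius N t ^ a * jetBound ε N t) *
          (coneRadius N t ^ a * ‖Y - Y'‖)) := by
          gcongr
          exact hG1.trans (by gcongr)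
      _ = _ := by ring
  · have := two_le_coneRadius N ht
    have := jetBound_pos hε N ht
    positivity
  · refine le_trans (le_of_eq ?_) (h₂ t ht)
    ring
  · have hM := datumBound_pos hε N ht
    have hR := two_le_coneRadius N ht
    have hr := timeRadius_pos N ht
    rw [jetBound]
    have h1 : (1 : ℝ) ≤ Real.exp (8 * coneRadius N t / timeRadius N t * coneRadius N t) :=
      Real.one_le_exp (by positivity)
    have h2 : (1 : ℝ) ≤ coneRadius N t ^ 2 := by nlinarith
    have h3 : datumBound ε N t ≤ coneRadius N t ^ 2 * datumBound ε N t *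
        Real.exp (8 * coneRadius N t / timeRadius N t * coneRadius N t) := by
      calc datumBound ε N t = 1 * datumBound ε N t * 1 := by ring
        _ ≤ _ := by gcongr
    nlinarith
  · have hx0 : 0 < x := by simpa using re_pos_of_near N ht (near t ht _ hx)
    have hY' : Y = fun i => (((Y i).re : ℝ) : ℂ) := by
      ext i
      exact Complex.ext (by simp) (by simp [hYr i])
    have hlt := (hwj t ht _ hx Y hY).1.trans_le (hwj t ht _ hx Y hY).2
    rw [hY'] at hlt
    rw [hY', weightedNonlinearity_ofReal hGg s β hx0 hlt, Complex.ofReal_im]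

end ConcreteData

section OneDimensional

open Metric Topology Set

/-- A nontrivial smooth solution of
`u_t + u_xx = s t ^ β g(t ^ α₀ u, t ^ α₁ u_x, t ^ α₂ u_xx)` on `D`, decaying faster than
`1 / e^{∘N}(1 / t ^ 2)`. -/
structure IsDecayingSolution (D : Set (ℝ × ℝ)) (s β : ℝ) (α : Fin 3 → ℝ) (g : (Fin 3 → ℝ) → ℝ)
    (N : ℕ) (C : ℝ) (u : ℝ → ℝ → ℝ) : Prop where
  contDiffOn : ContDiffOn ℝ (⊤ : ℕ∞) (fun p : ℝ × ℝ => u p.1 p.2) D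
  equation : ∀ x t, (x, t) ∈ D → deriv (fun τ => u x τ) t + deriv (deriv fun y => u y t) x =
    s * t ^ β * g (fun i => t ^ α i *
      ![u x t, deriv (fun y => u y t) x, deriv (deriv fun y => u y t) x] i)
  ne_zero : ∀ t ∈ Ioo (0 : ℝ) 1, u 0 t ≠ 0
  bound : ∀ t ∈ Ioo (0 : ℝ) 1, ∀ x, |x| ≤ iterExp N (1 / t ^ 2) →
    |u x t| * iterExp N (1 / t ^ 2) ≤ C * t

/-- The real points of the union of the cones over `(0, 1)`. -/
def realDomain (N : ℕ) : Set (ℝ × ℝ) :=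
  {p | ((p.1 : ℂ), (p.2 : ℂ)) ∈ coneUnion (Ioo 0 1) (coneRadius N) (timeRadius N) ∧
    p.2 ∈ Ioo (0 : ℝ) 1}

theorem isOpen_realDomain (N : ℕ) : IsOpen (realDomain N) :=
  ((isOpen_coneUnion _ _ _).preimage (f := fun p : ℝ × ℝ => ((p.1 : ℂ), (p.2 : ℂ)))
    (by fun_prop)).inter (isOpen_Ioo.preimage continuous_snd)

theorem mem_cone_of_abs_lt {N : ℕ} {x t : ℝ} (ht : t ∈ Ioo (0 : ℝ) 1)
    (hx : |x| < coneRadius N t) :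
    ((x : ℂ), (t : ℂ)) ∈ cone (coneRadius N t) (timeRadius N t) t := by
  have hR := two_le_coneRadius N ht
  have hr := timeRadius_pos N ht
  refine ⟨by simpa using hx, ?_⟩
  simp only [sub_self, norm_zero, Complex.norm_real, Real.norm_eq_abs]
  refine mul_pos hr ?_
  rw [sub_pos, div_lt_one (by linarith)]
  linarith

theorem mem_realDomain {N : ℕ} {x t : ℝ} (ht : t ∈ Ioo (0 : ℝ) 1)
    (hx : |x| ≤ iterExp N (1 / t ^ 2)) : (x, t) ∈ realDomain N :=
  ⟨⟨t, ht, mem_cone_of_abs_lt ht (hx.trans_lt (iterExp_lt_coneRadius N ht))⟩, ht⟩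

theorem isDecayingSolution_of_fixedPoint {G : (Fin 3 → ℂ) → ℂ} {g : (Fin 3 → ℝ) → ℝ} {η : ℝ}
    (hGg : ∀ y : Fin 3 → ℝ, ‖y‖ < η → G (fun i => (y i : ℂ)) = g y)
    {α : Fin 3 → ℝ} {β s ε : ℝ} {a N : ℕ} (hα : ∀ i, |α i| ≤ a) (hε : 0 < ε)
    (h₁ : ∀ t ∈ Ioo (0 : ℝ) 1, coneRadius N t ^ (3 * a + 2) * jetBound ε N t ≤ η) {κ : ℝ → ℝ}
    (h : CauchyData (Ioo 0 1) (coneRadius N) (timeRadius N) (datumBound ε N) (jetBound ε N)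
      κ (flatDatum ε N) (weightedNonlinearity s β α G)) {v : ℂ × ℂ → ℂ}
    (hv : CauchyData.Good (Ioo 0 1) (coneRadius N) (timeRadius N) (datumBound ε N) v)
    (hreal : RealOn (coneUnion (Ioo 0 1) (coneRadius N) (timeRadius N)) v)
    (hfix : ∀ p ∈ coneUnion (Ioo 0 1) (coneRadius N) (timeRadius N),
      v p = cauchyStep (flatDatum ε N) (weightedNonlinearity s β α G) v p) :
    IsDecayingSolution (realDomain N) s β α g N η
      fun x t => (flatDatum ε N t + prim₂ v (x, t)).re := by
  have hDo := isOpen_coneUnion (Ioo 0 1) (coneRadius N) (timeRadius N)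
  have hD := h.rayStable
  have hfd : ∀ p : ℂ × ℂ, p ∈ coneUnion (Ioo 0 1) (coneRadius N) (timeRadius N) →
      HasDerivAt (flatDatum ε N) (deriv (flatDatum ε N) p.2) p.2 := by
    rintro p ⟨t, ht, hp⟩
    exact ((h.diff_f t ht).differentiableAt (isOpen_ball.mem_nhds (h.mem_ball ht hp))).hasDerivAt
  have hx1 : ∀ x t, (x, t) ∈ realDomain N → HasDerivAt
      (fun y : ℝ => (flatDatum ε N t + prim₂ v (y, t)).re) (prim v (x, t)).re x := by
    intro x t hp
    exact ((hasDerivAt_prim₂ hDo hD hv.diff hp.1).const_add (flatDatum ε N t)).real_of_complex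
  have hx2 : ∀ x t, (x, t) ∈ realDomain N → HasDerivAt
      (deriv fun y : ℝ => (flatDatum ε N t + prim₂ v (y, t)).re) (v (x, t)).re x := by
    intro x t hp
    refine (hasDerivAt_prim hDo hD hv.diff hp.1).real_of_complex.congr_of_eventuallyEq ?_
    have hc : Continuous fun y : ℝ => (y, t) := by fun_prop
    filter_upwards [hc.continuousAt.preimage_mem_nhds ((isOpen_realDomain N).mem_nhds hp)] with y hy
    exact (hx1 y t hy).deriv
  constructor
  · have h1 : ContDiffOn ℂ (⊤ : ℕ∞) (fun p : ℂ × ℂ => flatDatum ε N p.2 + prim₂ v p)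
        (coneUnion (Ioo 0 1) (coneRadius N) (timeRadius N)) :=
      contDiffOn_of_differentiableOn_finiteDimensional hDo
        (h.differentiableOn_comp_snd.add (differentiableOn_prim₂ hDo hD hv.diff))
    have h2 : ContDiff ℝ (⊤ : ℕ∞) fun p : ℝ × ℝ => ((p.1 : ℂ), (p.2 : ℂ)) :=
      (Complex.ofRealCLM.contDiff.comp contDiff_fst).prodMk
        (Complex.ofRealCLM.contDiff.comp contDiff_snd)
    exact Complex.reCLM.contDiff.comp_contDiffOn ((h1.restrict_scalars ℝ).comp h2.contDiffOn
      fun p hp => hp.1)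
  · intro x t hp
    have htd : HasDerivAt (fun τ : ℝ => (flatDatum ε N τ + prim₂ v (x, τ)).re)
        (deriv (flatDatum ε N) t + prim₂ (dSnd v) (x, t)).re t :=
      ((hfd _ hp.1).add (hasDerivAt_prim₂_snd hDo hD hv.diff hp.1)).real_of_complex
    rw [htd.deriv, (hx2 x t hp).deriv, (hx1 x t hp).deriv, ← Complex.add_re]
    obtain ⟨t', ht', hc⟩ := id hp.1
    have hb := h.mem_ball ht' hc
    have hjet : jet (flatDatum ε N) v (x, t) = fun i => ((![(flatDatum ε N t +
        prim₂ v (x, t)).re, (prim v (x, t)).re, (v (x, t)).re] i : ℝ) : ℂ) := by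
      have e : ∀ z : ℂ, z.im = 0 → z = (z.re : ℂ) := fun z hz => Complex.ext (by simp) (by simp [hz])
      ext i
      fin_cases i
      · refine e _ ?_
        change (flatDatum ε N (t : ℂ) + prim₂ v ((x : ℂ), (t : ℂ))).im = 0
        rw [Complex.add_im, hreal.prim₂ hD hv.diff.continuousOn x t hp.1, h.real_f t' ht' t hb,
          add_zero]
      · exact e _ (hreal.prim hD hv.diff.continuousOn x t hp.1)
      · exact e _ (hreal x t hp.1)
    have hlt := h.norm_jet_lt hv.diff.continuousOn ht' (hv.bound t' ht') hc
    rw [hjet] at hlt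
    have hnear : ‖(t : ℂ) - t'‖ ≤ 2 * timeRadius N t' := by
      have h4 : ‖(t : ℂ) - t'‖ < timeRadius N t' := mem_ball_iff_norm.1 hb
      have := timeRadius_pos N ht'
      linarith
    have hlt' := norm_weightJet_lt hε ht' hnear hα (h₁ t' ht') hlt
    have hF := weightedNonlinearity_ofReal hGg s β hp.2.1 (hlt'.1.trans_le hlt'.2)
    have hfix' := hfix _ hp.1
    rw [cauchyStep, hjet, hF] at hfix'
    dsimp only at hfix'
    refine (congrArg Complex.re ?_).trans (Complex.ofReal_re _)
    linear_combination hfix'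
  · intro t ht
    have : (flatDatum ε N t + prim₂ v (((0 : ℝ) : ℂ), t)).re =
        ε * Real.exp (-iterExp (N + 2) (1 / t)) := by
      rw [flatDatum_ofReal, prim₂, Complex.ofReal_zero, zero_pow two_ne_zero, zero_mul, add_zero,
        Complex.ofReal_re]
    rw [this]
    positivity
  · intro t ht x hx
    have hxR := hx.trans_lt (iterExp_lt_coneRadius N ht)
    have hc := mem_cone_of_abs_lt ht hxR
    have hlt := h.norm_jet_lt hv.diff.continuousOn ht (hv.bound t ht) hc
    have h3 : |(flatDatum ε N t + prim₂ v (x, t)).re| ≤ jetBound ε N t :=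
      (Complex.abs_re_le_norm _).trans ((norm_le_pi_norm (jet (flatDatum ε N) v (x, t)) 0).trans
        hlt.le)
    have hR := two_le_coneRadius N ht
    have hRt := two_div_le_coneRadius N t
    rw [div_le_iff₀ ht.1] at hRt
    have hB := jetBound_pos hε N ht
    calc _ ≤ jetBound ε N t * coneRadius N t := by
          gcongr
          · exact (abs_nonneg x).trans hx
          · exact (iterExp_lt_coneRadius N ht).le
      _ ≤ jetBound ε N t * coneRadius N t * (coneRadius N t * t) :=
          le_mul_of_one_le_right (by positivity) (by linarith)
      _ = coneRadius N t ^ 2 * jetBound ε N t * t := by ring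
      _ ≤ coneRadius N t ^ (3 * a + 2) * jetBound ε N t * t := by
          have := ht.1.le
          gcongr
          · linarith
          · omega
      _ ≤ η * t := mul_le_mul_of_nonneg_right (h₁ t ht) ht.1.le

theorem exists_isDecayingSolution {g : (Fin 3 → ℝ) → ℝ} (hg : AnalyticAt ℝ g 0) (hg0 : g 0 = 0)
    (hg' : fderiv ℝ g 0 = 0) (α : Fin 3 → ℝ) (β : ℝ) (N : ℕ) :
    ∃ (u : ℝ → ℝ → ℝ → ℝ) (C : ℝ), ∀ s, |s| ≤ 1 →
      IsDecayingSolution (realDomain N) s β α g N C (u s) := by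
  obtain ⟨G, η, L, hη, hL, hG, hG0, hGL, hGg⟩ :=
    hg.exists_holomorphic_extension_of_fderiv_eq_zero hg0 hg'
  obtain ⟨a, ha⟩ := exists_nat_ge (|β| + ∑ i, |α i|)
  have hα : ∀ i, |α i| ≤ a := fun i => by
    have := Finset.single_le_sum (f := fun i => |α i|) (fun _ _ => abs_nonneg _) (Finset.mem_univ i)
    have := abs_nonneg β
    linarith
  have hβ : |β| ≤ a := by
    have : 0 ≤ ∑ i, |α i| := Finset.sum_nonneg fun _ _ => abs_nonneg _
    linarith
  obtain ⟨ε, hε, hb⟩ := exists_jetBound_le N (3 * a + 2)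
    (c₁ := min η (1 / (4 * (L + 1)))) (by positivity)
  have h₁ : ∀ t ∈ Ioo (0 : ℝ) 1, coneRadius N t ^ (3 * a + 2) * jetBound ε N t ≤ η :=
    fun t ht => (hb t ht).trans (min_le_left _ _)
  have h₂ : ∀ t ∈ Ioo (0 : ℝ) 1,
      L * (coneRadius N t ^ (3 * a + 2) * jetBound ε N t) ≤ 1 / 4 := fun t ht => by
    refine (mul_le_mul_of_nonneg_left ((hb t ht).trans (min_le_right _ _)) hL).trans ?_
    rw [mul_one_div, div_le_div_iff₀ (by positivity) (by norm_num)]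
    linarith
  have key : ∀ s : ℝ, |s| ≤ 1 → ∃ u, IsDecayingSolution (realDomain N) s β α g N η u := by
    intro s hs
    have h := cauchyData_weightedNonlinearity hL hG hG0 hGL hGg hα hβ hε hs h₁ h₂
    obtain ⟨v, hv, hreal, hfix⟩ := h.exists_fixedPoint
    exact ⟨_, isDecayingSolution_of_fixedPoint hGg hα hε h₁ h hv hreal hfix⟩
  choose! u hu using key
  exact ⟨u, η, hu⟩

end OneDimensional

section Reduction

open Set Topology

theorem pderiv'_comp_apply {n : ℕ} (i i₀ : Fin n) (h : ℝ → ℝ) :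
    pderiv' i (fun y => h (y i₀)) = fun x => (Pi.single i₀ (deriv h (x i₀)) : Fin n → ℝ) i := by
  ext x
  rcases eq_or_ne i i₀ with rfl | hi
  · simp [pderiv']
  · simp [pderiv', Function.update_of_ne hi.symm, Pi.single_eq_of_ne hi]

theorem pderiv'_pderiv'_comp_apply {n : ℕ} (i j i₀ : Fin n) (h : ℝ → ℝ) (x : Fin n → ℝ) :
    pderiv' i (pderiv' j (fun y => h (y i₀))) x =
      (Pi.single i₀ (Pi.single i₀ (deriv (deriv h) (x i₀))) : Fin n → Fin n → ℝ) i j := by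
  rcases eq_or_ne j i₀ with rfl | hj
  · rw [pderiv'_comp_apply]
    simp only [Pi.single_eq_same]
    rw [pderiv'_comp_apply]
    rcases eq_or_ne i j with rfl | hi
    · simp
    · simp [Pi.single_eq_of_ne hi]
  · rw [pderiv'_comp_apply]
    simp only [Pi.single_eq_of_ne hj]
    rcases eq_or_ne i i₀ with rfl | hi
    · simp [pderiv', Pi.single_eq_of_ne hj]
    · simp [pderiv', Pi.single_eq_of_ne hi]

/-- The jet of a function of the `i₀`-th coordinate, as a function of its one-dimensional jet. -/
noncomputable def liftJet {n : ℕ} (i₀ : Fin n) :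
    (Fin 3 → ℝ) →L[ℝ] ℝ × (Fin n → ℝ) × (Fin n → Fin n → ℝ) :=
  (ContinuousLinearMap.proj 0).prod
    (((ContinuousLinearMap.single ℝ (fun _ : Fin n => ℝ) i₀).comp (ContinuousLinearMap.proj 1)).prod
      (((ContinuousLinearMap.single ℝ (fun _ : Fin n => Fin n → ℝ) i₀).comp
        (ContinuousLinearMap.single ℝ (fun _ : Fin n => ℝ) i₀)).comp (ContinuousLinearMap.proj 2)))

theorem liftJet_apply {n : ℕ} (i₀ : Fin n) (y : Fin 3 → ℝ) :
    liftJet i₀ y = (y 0, Pi.single i₀ (y 1), Pi.single i₀ (Pi.single i₀ (y 2))) := rfl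

theorem one_le_iterExp {t : ℝ} (ht : t ∈ Ioo (0 : ℝ) 1) (N : ℕ) : 1 ≤ iterExp N (1 / t ^ 2) :=
  ((one_le_div (pow_pos ht.1 2)).2 (pow_le_one₀ ht.1.le ht.2.le)).trans (le_iterExp _ _)

theorem abs_apply_le_sqrt_sum_sq {n : ℕ} (x : Fin n → ℝ) (i : Fin n) :
    |x i| ≤ √(∑ j, x j ^ 2) :=
  Real.abs_le_sqrt (Finset.single_le_sum (f := fun j => x j ^ 2) (fun _ _ => sq_nonneg _)
    (Finset.mem_univ i))

theorem IsDecayingSolution.tendsto {D : Set (ℝ × ℝ)} {s β : ℝ} {α : Fin 3 → ℝ}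
    {g : (Fin 3 → ℝ) → ℝ} {N : ℕ} {C : ℝ} {u : ℝ → ℝ → ℝ}
    (h : IsDecayingSolution D s β α g N C u) (x : ℝ) :
    Tendsto (fun t => u x t) (𝓝[>] 0) (𝓝 0) := by
  have h1 : Tendsto (fun t : ℝ => 1 / t ^ 2) (𝓝[>] 0) atTop := by
    simp_rw [one_div, ← inv_pow]
    exact (tendsto_pow_atTop two_ne_zero).comp tendsto_inv_nhdsGT_zero
  have h2 : Tendsto (fun t : ℝ => C * t) (𝓝[>] 0) (𝓝 0) :=
    ((continuous_const_mul C).tendsto' 0 0 (mul_zero C)).mono_left nhdsWithin_le_nhds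
  refine squeeze_zero_norm' ?_ h2
  filter_upwards [Ioo_mem_nhdsGT one_pos, h1.eventually_ge_atTop |x|] with t ht hx
  exact (le_mul_of_one_le_right (norm_nonneg _) (one_le_iterExp ht N)).trans
    (h.bound t ht x (hx.trans (le_iterExp _ _)))

theorem IsDecayingSolution.limsup_eq_zero {D : Set (ℝ × ℝ)} {s β : ℝ} {α : Fin 3 → ℝ}
    {g : (Fin 3 → ℝ) → ℝ} {N : ℕ} {C : ℝ} {u : ℝ → ℝ → ℝ}
    (h : IsDecayingSolution D s β α g N C u) {n : ℕ} (i₀ : Fin n) {w : (Fin n → ℝ) → ℝ → ℝ}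
    (hw : ∀ x, ∀ t ∈ Ioo (0 : ℝ) 1, w x t = u (x i₀) t) :
    limsup (fun t : ℝ => sSup ((fun x => |w x t|) ''
      {x : Fin n → ℝ | √(∑ i, x i ^ 2) ≤ iterExp N (1 / t ^ 2)}) * iterExp N (1 / t ^ 2))
      (𝓝[>] 0) = 0 := by
  have h2 : Tendsto (fun t : ℝ => C * t) (𝓝[>] 0) (𝓝 0) :=
    ((continuous_const_mul C).tendsto' 0 0 (mul_zero C)).mono_left nhdsWithin_le_nhds
  refine (squeeze_zero' ?_ ?_ h2).limsup_eq
  · filter_upwards [Ioo_mem_nhdsGT one_pos] with t ht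
    refine mul_nonneg (Real.sSup_nonneg ?_) (zero_le_one.trans (one_le_iterExp ht N))
    rintro _ ⟨x, -, rfl⟩
    exact abs_nonneg _
  · filter_upwards [Ioo_mem_nhdsGT one_pos] with t ht
    have hE := zero_lt_one.trans_le (one_le_iterExp ht N)
    have hC : 0 ≤ C * t := (mul_nonneg (abs_nonneg _) hE.le).trans
      (h.bound t ht 0 (by rw [abs_zero]; exact hE.le))
    rw [← le_div_iff₀ hE]
    refine Real.sSup_le ?_ (div_nonneg hC hE.le)
    rintro _ ⟨x, hx, rfl⟩
    rw [le_div_iff₀ hE]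
    simp only [hw x t ht]
    exact h.bound t ht _ ((abs_apply_le_sqrt_sum_sq x i₀).trans hx)

end Reduction

/-- Main counterexample theorem (Theorem 1.4): for any analytic nonlinearity `𝒬`
vanishing to second order at the origin, any parameters `α₁, α₂, α₃, β ∈ ℝ` and any
`N ≥ 1`, there is a family `{u_s}_{s ∈ [-1,1]}` of nontrivial solutions of
`∂ₜu + Δu = s·t^β·𝒬(t^{α₁}u, t^{α₂}∇u, t^{α₃}D²u)` on a region containing
`{|x| ≤ e^{∘N}(1/t²), 0 < t < 1}`, each extending continuously by `0` to `t = 0` and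
decaying faster than `1/e^{∘N}(1/t²)`. -/
theorem tikhonov_general_counterexample (n : ℕ) (hn : 1 ≤ n)
    (Q : ℝ → (Fin n → ℝ) → (Fin n → Fin n → ℝ) → ℝ)
    (hQan : AnalyticAt ℝ
      (fun p : ℝ × (Fin n → ℝ) × (Fin n → Fin n → ℝ) => Q p.1 p.2.1 p.2.2) 0)
    (hQ0 : Q 0 0 0 = 0)
    (hQ'0 : fderiv ℝ
      (fun p : ℝ × (Fin n → ℝ) × (Fin n → Fin n → ℝ) => Q p.1 p.2.1 p.2.2) 0 = 0)
    (α₁ α₂ α₃ β : ℝ) (N : ℕ) (hN : 1 ≤ N) :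
    ∃ (U : Set ((Fin n → ℝ) × ℝ)) (u : ℝ → (Fin n → ℝ) → ℝ → ℝ),
      {p : (Fin n → ℝ) × ℝ | p.2 ∈ Set.Ioo (0 : ℝ) 1 ∧
          Real.sqrt (∑ i, p.1 i ^ 2) ≤ iterExp N (1 / p.2 ^ 2)} ⊆ U ∧
      U ⊆ (Set.univ : Set (Fin n → ℝ)) ×ˢ Set.Ioo (0 : ℝ) 1 ∧
      ∀ s : ℝ, s ∈ Set.Icc (-1 : ℝ) 1 →
        ContDiffOn ℝ (⊤ : ℕ∞) (fun p : (Fin n → ℝ) × ℝ => u s p.1 p.2) U ∧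
        (∀ (x : Fin n → ℝ) (t : ℝ), (x, t) ∈ U →
          deriv (fun τ => u s x τ) t +
              (∑ i, pderiv' i (pderiv' i (fun y => u s y t)) x) =
            s * t ^ β *
              Q (t ^ α₁ * u s x t)
                (fun i => t ^ α₂ * pderiv' i (fun y => u s y t) x)
                (fun i j => t ^ α₃ * pderiv' i (pderiv' j (fun y => u s y t)) x)) ∧
        (∀ x : Fin n → ℝ, u s x 0 = 0) ∧
        (∀ x : Fin n → ℝ,
          Tendsto (fun t => u s x t) (nhdsWithin 0 (Set.Ioi 0)) (nhds 0)) ∧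
        (∃ p ∈ U, u s p.1 p.2 ≠ 0) ∧
        limsup (fun t : ℝ =>
            sSup ((fun x => |u s x t|) ''
                {x : Fin n → ℝ | Real.sqrt (∑ i, x i ^ 2) ≤ iterExp N (1 / t ^ 2)}) *
              iterExp N (1 / t ^ 2)) (nhdsWithin 0 (Set.Ioi 0)) = 0 := by
  classical
  let i₀ : Fin n := ⟨0, hn⟩
  obtain ⟨u, C, hu⟩ := exists_isDecayingSolution
    (g := (fun p : ℝ × (Fin n → ℝ) × (Fin n → Fin n → ℝ) => Q p.1 p.2.1 p.2.2) ∘ liftJet i₀)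
    (AnalyticAt.comp (by rwa [map_zero]) ((liftJet i₀).analyticAt 0))
    (by simpa [liftJet_apply] using hQ0)
    (by
      rw [fderiv_comp _ (by rw [map_zero]; exact hQan.differentiableAt)
        (liftJet i₀).differentiableAt, map_zero, hQ'0, ContinuousLinearMap.zero_comp])
    ![α₁, α₂, α₃] β N
  have hmem : ∀ (x : Fin n → ℝ) (t : ℝ), t ∈ Set.Ioo (0 : ℝ) 1 →
      Real.sqrt (∑ i, x i ^ 2) ≤ iterExp N (1 / t ^ 2) → (x i₀, t) ∈ realDomain N := fun x t ht hx =>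
    mem_realDomain ht ((abs_apply_le_sqrt_sum_sq x i₀).trans hx)
  refine ⟨{p | (p.1 i₀, p.2) ∈ realDomain N}, fun s x t => if t = 0 then 0 else u s (x i₀) t,
    fun p hp => hmem p.1 p.2 hp.1 hp.2, fun p hp => ⟨trivial, hp.2⟩, fun s hs => ?_⟩
  have h := hu s (abs_le.2 hs)
  have hw : ∀ x : Fin n → ℝ, ∀ t ∈ Set.Ioo (0 : ℝ) 1,
      (if t = 0 then 0 else u s (x i₀) t) = u s (x i₀) t := fun x t ht => if_neg ht.1.ne'
  refine ⟨?_, ?_, fun x => if_pos rfl, fun x => ?_, ?_, h.limsup_eq_zero i₀ hw⟩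
  · have hc : ContDiff ℝ (⊤ : ℕ∞) fun p : (Fin n → ℝ) × ℝ => (p.1 i₀, p.2) := by fun_prop
    exact (h.contDiffOn.comp hc.contDiffOn fun p hp => hp).congr fun p hp => hw p.1 p.2 hp.2
  · intro x t hp
    have ht : t ∈ Set.Ioo (0 : ℝ) 1 := hp.2
    have e1 : deriv (fun τ => if τ = 0 then 0 else u s (x i₀) τ) t =
        deriv (fun τ => u s (x i₀) τ) t :=
      Filter.EventuallyEq.deriv_eq ((eventually_ne_nhds ht.1.ne').mono fun τ hτ => if_neg hτ)
    simp only [if_neg ht.1.ne']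
    rw [e1]
    simp only [pderiv'_pderiv'_comp_apply _ _ i₀ fun y => u s y t]
    simp only [pderiv'_comp_apply _ i₀ fun y => u s y t]
    rw [Finset.sum_eq_single_of_mem i₀ (Finset.mem_univ _) fun i _ hi => by
      rw [Pi.single_eq_of_ne hi, Pi.zero_apply], Pi.single_eq_same, Pi.single_eq_same,
      h.equation _ _ hp]
    simp only [Function.comp_apply, liftJet_apply]
    congr 2
    · ext i
      rcases eq_or_ne i i₀ with rfl | hi
      · simp
      · simp [Pi.single_eq_of_ne hi]
    · ext i j
      rcases eq_or_ne i i₀ with rfl | hi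
      · rcases eq_or_ne j i₀ with rfl | hj
        · simp
        · simp [Pi.single_eq_of_ne hj]
      · simp [Pi.single_eq_of_ne hi]
  · refine (h.tendsto (x i₀)).congr' ?_
    filter_upwards [self_mem_nhdsWithin] with t ht
    exact (if_neg (ne_of_gt ht)).symm
  · have ht : (1 / 2 : ℝ) ∈ Set.Ioo (0 : ℝ) 1 := by norm_num
    refine ⟨(0, 1 / 2), hmem 0 _ ht ?_, ?_⟩
    · simpa using zero_le_one.trans (one_le_iterExp ht N)
    · exact (hw 0 _ ht).trans_ne (h.ne_zero _ ht)
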